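/- arXiv:2304.12095 — 3 statements merged into one kernel-verified Lean document; each statement's English description precedes it below -/
import Mathlib

section
/- (Wei duality) Assume m_1 = … = m_ℓ = m. For a code 𝒞 ⊆ 𝕄 and r ∈ ℤ, let D_r(𝒞) = {d_{r+sm}(𝒞) : s ∈ ℤ, 1 ≤ r+sm ≤ dim(𝒞)} and 𝐷̄_r(𝒞) = {n + 1 − d_{r+sm}(𝒞) : s ∈ ℤ, 1 ≤ r+sm ≤ dim(𝒞)}. Then for every r ∈ {1,…,m}, D_r(𝒞^⊥) = {1,…,n} \ 𝐷̄_{r+dim(𝒞)}(𝒞). -/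
open Matrix Finset

section SumRank

variable {F : Type*} [Field F] [Fintype F] {ℓ : ℕ} {m n : Fin ℓ → ℕ}

/-- The sum-rank weight of a tuple of matrices. -/
noncomputable def srk (C : ∀ i : Fin ℓ, Matrix (Fin (m i)) (Fin (n i)) F) : ℕ :=
  ∑ i, (C i).rank

/-- The weighted sum `∑ m i * rank (C i)`. -/
noncomputable def wsum (C : ∀ i : Fin ℓ, Matrix (Fin (m i)) (Fin (n i)) F) : ℕ :=
  ∑ i, m i * (C i).rank

/-- The minimum sum-rank distance of a code. -/
noncomputable def dmin (𝒞 : Submodule F (∀ i : Fin ℓ, Matrix (Fin (m i)) (Fin (n i)) F)) : ℕ :=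
  sInf {w | ∃ C ∈ 𝒞, C ≠ 0 ∧ srk C = w}

/-- The maximum sum-rank weight of a code. -/
noncomputable def maxsrk (𝒞 : Submodule F (∀ i : Fin ℓ, Matrix (Fin (m i)) (Fin (n i)) F)) : ℕ :=
  sSup {w | ∃ C ∈ 𝒞, srk C = w}

/-- An optimal rank-metric anticode in `F^(m×n)`. -/
def IsOptRkAnticode {m n : ℕ} (A : Submodule F (Matrix (Fin m) (Fin n) F)) : Prop :=
  Module.finrank F A = m * sSup {r | ∃ M ∈ A, (M : Matrix (Fin m) (Fin n) F).rank = r}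

/-- An optimal sum-rank-metric anticode. -/
def IsOptAnticode (𝒞 : Submodule F (∀ i : Fin ℓ, Matrix (Fin (m i)) (Fin (n i)) F)) : Prop :=
  Module.finrank F 𝒞 = sSup {w | ∃ C ∈ 𝒞, wsum C = w}

/-- The weight of a code. -/
noncomputable def wtCode (𝒞 : Submodule F (∀ i : Fin ℓ, Matrix (Fin (m i)) (Fin (n i)) F)) : ℕ :=
  sInf {w | ∃ A : ∀ i : Fin ℓ, Submodule F (Matrix (Fin (m i)) (Fin (n i)) F),
    (∀ i, IsOptRkAnticode (A i)) ∧ 𝒞 ≤ Submodule.pi Set.univ A ∧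
    w = maxsrk (Submodule.pi Set.univ A)}

/-- The `r`-th generalized sum-rank weight of a code. -/
noncomputable def genWt (𝒞 : Submodule F (∀ i : Fin ℓ, Matrix (Fin (m i)) (Fin (n i)) F))
    (r : ℕ) : ℕ :=
  sInf {w | ∃ 𝒟 : Submodule F (∀ i : Fin ℓ, Matrix (Fin (m i)) (Fin (n i)) F),
    𝒟 ≤ 𝒞 ∧ r ≤ Module.finrank F 𝒟 ∧ w = wtCode 𝒟}

/-- The trace-dual of a code. -/
def dualCode (𝒞 : Submodule F (∀ i : Fin ℓ, Matrix (Fin (m i)) (Fin (n i)) F)) :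
    Submodule F (∀ i : Fin ℓ, Matrix (Fin (m i)) (Fin (n i)) F) where
  carrier := {D | ∀ C ∈ 𝒞, ∑ i, Matrix.trace (D i * (C i)ᵀ) = 0}
  add_mem' := by
    intro a b ha hb C hC
    have h1 := ha C hC
    have h2 := hb C hC
    simp only [Pi.add_apply, Matrix.add_mul, Matrix.trace_add, Finset.sum_add_distrib,
      Set.mem_setOf_eq] at *
    rw [h1, h2, add_zero]
  zero_mem' := by
    intro C hC
    simp
  smul_mem' := by
    intro r a ha C hC
    have h1 := ha C hC
    simp only [Pi.smul_apply, Matrix.smul_mul, Matrix.trace_smul, ← Finset.smul_sum,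
      Set.mem_setOf_eq] at *
    rw [h1, smul_zero]

/-- The MSRD property. -/
def IsMSRD (𝒞 : Submodule F (∀ i : Fin ℓ, Matrix (Fin (m i)) (Fin (n i)) F)) : Prop :=
  ∃ (j : Fin ℓ) (δ : ℕ), δ ≤ n j - 1 ∧
    dmin 𝒞 = ∑ i ∈ Finset.Iio j, n i + δ + 1 ∧
    Module.finrank F 𝒞 = ∑ i ∈ Finset.Ici j, m i * n i - δ * m j

end SumRank

/-- The set `D_r(𝒞) = {d_{r+sm}(𝒞) : s ∈ ℤ, 1 ≤ r+sm ≤ dim 𝒞}`. -/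
noncomputable def Dset {F : Type*} [Field F] [Fintype F] {ℓ mm : ℕ} {n : Fin ℓ → ℕ}
    (𝒞 : Submodule F (∀ i : Fin ℓ, Matrix (Fin mm) (Fin (n i)) F)) (r : ℤ) : Set ℕ :=
  {w | ∃ s : ℤ, 1 ≤ r + s * mm ∧ r + s * mm ≤ Module.finrank F 𝒞 ∧
    w = genWt 𝒞 (r + s * mm).toNat}

/-- The set `D̄_r(𝒞) = {n + 1 - d_{r+sm}(𝒞) : s ∈ ℤ, 1 ≤ r+sm ≤ dim 𝒞}`. -/
noncomputable def DbarSet {F : Type*} [Field F] [Fintype F] {ℓ mm : ℕ} {n : Fin ℓ → ℕ}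
    (𝒞 : Submodule F (∀ i : Fin ℓ, Matrix (Fin mm) (Fin (n i)) F)) (r : ℤ) : Set ℕ :=
  {w | ∃ s : ℤ, 1 ≤ r + s * mm ∧ r + s * mm ≤ Module.finrank F 𝒞 ∧
    w = (∑ i, n i) + 1 - genWt 𝒞 (r + s * mm).toNat}


theorem indep_update_aux {F V ι : Type*} [Field F] [AddCommGroup V] [Module F V] [Fintype ι]
    [DecidableEq ι] (g : ι → V) (hg : LinearIndependent F g) (k : ι) (w : V) :
    LinearIndependent F (Function.update g k w) ∨
    LinearIndependent F (Function.update g k (w + g k)) := by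
  obtain ⟨φ, hφ⟩ : ∃ φ : V →ₗ[F] F, ∀ i, φ (g i) = if i = k then 1 else 0 := by
    obtain ⟨ψ, hψ⟩ := LinearMap.exists_extend ((Finsupp.lapply k : (ι →₀ F) →ₗ[F] F) ∘ₗ hg.repr)
    refine ⟨ψ, fun i => ?_⟩
    have hm : g i ∈ Submodule.span F (Set.range g) := Submodule.subset_span ⟨i, rfl⟩
    have := LinearMap.congr_fun hψ ⟨g i, hm⟩
    simp only [LinearMap.comp_apply, Submodule.subtype_apply] at this
    rw [this]
    have h2 : hg.repr ⟨g i, hm⟩ = Finsupp.single i 1 := hg.repr_eq_single i _ rfl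
    simp [h2, Finsupp.single_apply]
  have key : ∀ x : V, φ x ≠ 0 → LinearIndependent F (Function.update g k x) := by
    intro x hx
    rw [Fintype.linearIndependent_iff] at hg ⊢
    intro c hc
    have h1 : ∀ i, φ (Function.update g k x i) = if i = k then φ x else 0 := by
      intro i
      by_cases h : i = k
      · subst h; simp
      · simp [h, hφ]
    have hck : c k = 0 := by
      have := congrArg φ hc
      simp only [map_sum, map_smul, h1, map_zero, smul_eq_mul, mul_ite, mul_zero,
        Finset.sum_ite_eq', Finset.mem_univ, if_true] at this
      exact (mul_eq_zero.1 this).resolve_right hx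
    apply hg c
    rw [← hc]
    refine Finset.sum_congr rfl fun i _ => ?_
    by_cases h : i = k
    · subst h; simp [hck]
    · simp [h]
  by_cases hw : φ w = 0
  · right; apply key; simp [hw, hφ]
  · left; exact key w hw

/-- elements of `A` whose first `p` rows vanish -/
def rowVan {F V : Type*} [Field F] [AddCommGroup V] [Module F V] {m : ℕ}
    (A : Submodule F (Fin m → V)) (p : ℕ) : Submodule F (Fin m → V) where
  carrier := {M | M ∈ A ∧ ∀ i : Fin m, i.1 < p → M i = 0}
  add_mem' := by
    rintro a b ⟨ha, ha'⟩ ⟨hb, hb'⟩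
    exact ⟨A.add_mem ha hb, fun i hi => by simp [ha' i hi, hb' i hi]⟩
  zero_mem' := ⟨A.zero_mem, fun i _ => rfl⟩
  smul_mem' := by
    rintro c a ⟨ha, ha'⟩
    exact ⟨A.smul_mem c ha, fun i hi => by simp [ha' i hi]⟩

/-- leading rows at `i` -/
def rowLead {F V : Type*} [Field F] [AddCommGroup V] [Module F V] {m : ℕ}
    (A : Submodule F (Fin m → V)) (i : Fin m) : Submodule F V :=
  (rowVan A i.1).map (LinearMap.proj i : (Fin m → V) →ₗ[F] V)

theorem finrank_rowLead {F V : Type*} [Field F] [AddCommGroup V] [Module F V]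
    [FiniteDimensional F V] {m : ℕ}
    (A : Submodule F (Fin m → V)) :
    Module.finrank F A = ∑ i, Module.finrank F (rowLead A i) := by
  have step : ∀ i : Fin m, Module.finrank F (rowVan A i.1) =
      Module.finrank F (rowLead A i) + Module.finrank F (rowVan A (i.1+1)) := by
    intro i
    have h := LinearMap.finrank_range_add_finrank_ker
      ((LinearMap.proj i : (Fin m → V) →ₗ[F] V).domRestrict (rowVan A i.1))
    rw [← h]
    congr 1
    · rw [LinearMap.range_domRestrict]; rfl
    · refine LinearEquiv.finrank_eq (LinearEquiv.ofBijective
        ((((rowVan A i.1).subtype).domRestrict _).codRestrict (rowVan A (i.1+1)) ?_) ⟨?_, ?_⟩)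
      · rintro ⟨⟨M, hM, hM'⟩, hk⟩
        refine ⟨hM, fun j hj => ?_⟩
        rcases Nat.lt_succ_iff_lt_or_eq.1 hj with h | h
        · exact hM' j h
        · have : j = i := Fin.ext h
          subst this
          simpa using hk
      · intro a b hab
        apply Subtype.ext; apply Subtype.ext
        have h3 := congrArg (fun x : rowVan A (i.1+1) => (x : Fin m → V)) hab
        exact h3
      · rintro ⟨M, hM, hM'⟩
        refine ⟨⟨⟨M, hM, fun j hj => hM' j (by omega)⟩, ?_⟩, rfl⟩
        simpa using hM' i (by omega)
  have gen : ∀ p ≤ m, Module.finrank F A =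
      ∑ i with i.1 < p, Module.finrank F (rowLead A i) + Module.finrank F (rowVan A p) := by
    intro p
    induction p with
    | zero =>
      intro _
      have : rowVan A 0 = A := by ext M; simp [rowVan]
      simp only [Nat.not_lt_zero, Finset.filter_false, Finset.sum_empty, zero_add]
      rw [this]
    | succ p ih =>
      intro hp
      rw [ih (by omega), step ⟨p, hp⟩]
      have : (univ.filter fun i : Fin m => i.1 < p+1) =
        insert ⟨p, hp⟩ (univ.filter fun i : Fin m => i.1 < p) := by
        ext i; simp [Fin.ext_iff]; omega
      rw [this, Finset.sum_insert (by simp)]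
      simp only
      omega
  have h := gen m le_rfl
  have h0 : rowVan A m = ⊥ := by
    rw [eq_bot_iff]
    rintro M ⟨_, hM⟩
    ext i
    exact hM i i.2
  rw [h, h0]
  simp

theorem transversal_rank {F V ι : Type*} [Field F] [AddCommGroup V] [Module F V]
    [FiniteDimensional F V] [Fintype ι] {m : ℕ}
    (A : Submodule F (Fin m → V)) (e : ι → Fin m) (he : Function.Injective e)
    (u : ι → V) (hu : ∀ k, u k ∈ rowLead A (e k)) (hli : LinearIndependent F u) :
    ∃ M ∈ A, Fintype.card ι ≤ Module.finrank F (Submodule.span F (Set.range M)) := by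
  classical
  have gen : ∀ p ≤ m, ∃ M ∈ A, LinearIndependent F
      (fun k => if (e k).1 < p then M (e k) else u k) := by
    intro p
    induction p with
    | zero => intro _; exact ⟨0, A.zero_mem, by simpa using hli⟩
    | succ p ih =>
      intro hp
      obtain ⟨M, hM, hl⟩ := ih (by omega)
      by_cases hk : ∃ k, (e k).1 = p
      · obtain ⟨k, hk⟩ := hk
        obtain ⟨N, ⟨hN, hN0⟩, hNk⟩ := hu k
        have hNk : N (e k) = u k := hNk
        have hne : ∀ i, i ≠ k → (e i).1 ≠ p := by
          intro i hi h
          exact hi (he (Fin.ext (h.trans hk.symm)))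
        rcases indep_update_aux _ hl k (M (e k)) with h | h
        · refine ⟨M, hM, ?_⟩
          convert h using 1
          funext i
          by_cases hi : i = k
          · subst hi; simp [hk]
          · have := hne i hi
            rw [Function.update_of_ne hi]
            have : (e i).1 < p + 1 ↔ (e i).1 < p := by omega
            simp only [this]
        · refine ⟨M + N, A.add_mem hM hN, ?_⟩
          convert h using 1
          funext i
          by_cases hi : i = k
          · subst hi; simp [hk, hNk]
          · have := hne i hi
            rw [Function.update_of_ne hi]
            have h2 : (e i).1 < p + 1 ↔ (e i).1 < p := by omega
            simp only [h2]
            split_ifs with h3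
            · simp [hN0 (e i) (by omega)]
            · rfl
      · refine ⟨M, hM, ?_⟩
        convert hl using 1
        funext i
        have : (e i).1 ≠ p := fun h => hk ⟨i, h⟩
        have : (e i).1 < p + 1 ↔ (e i).1 < p := by omega
        simp only [this]
  obtain ⟨M, hM, hl⟩ := gen m le_rfl
  refine ⟨M, hM, ?_⟩
  simp only [Fin.is_lt, if_true] at hl
  rw [← finrank_span_eq_card hl]
  apply Submodule.finrank_mono
  apply Submodule.span_mono
  rintro _ ⟨i, rfl⟩
  exact ⟨_, rfl⟩

theorem greedy_li {F V : Type*} [Field F] [AddCommGroup V] [Module F V]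
    [FiniteDimensional F V] (s : ℕ) (L : Fin s → Submodule F V)
    (h : ∀ k, k.1 + 1 ≤ Module.finrank F (L k)) :
    ∃ u : Fin s → V, (∀ k, u k ∈ L k) ∧ LinearIndependent F u := by
  induction s with
  | zero => exact ⟨fun _ => 0, fun k => k.elim0, linearIndependent_empty_type⟩
  | succ s ih =>
    obtain ⟨u, hu, hl⟩ := ih (fun k => L k.castSucc) (fun k => h k.castSucc)
    have : ∃ x ∈ L (Fin.last s), x ∉ Submodule.span F (Set.range u) := by
      by_contra! hc
      have h1 := Submodule.finrank_mono (show L (Fin.last s) ≤ _ from hc)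
      rw [finrank_span_eq_card hl] at h1
      have := h (Fin.last s)
      simp at this h1
      omega
    obtain ⟨x, hx, hx'⟩ := this
    refine ⟨Fin.snoc u x, fun k => ?_, ?_⟩
    · refine Fin.lastCases ?_ (fun i => ?_) k
      · simpa using hx
      · simpa using hu i
    · rw [linearIndependent_finSnoc]
      exact ⟨hl, hx'⟩

theorem exists_spanning {F W : Type*} [Field F] [AddCommGroup W] [Module F W]
    [FiniteDimensional F W] {m : ℕ} (y : W) (hy : y ≠ 0) (S : Finset (Fin m))
    (hS : Module.finrank F W ≤ S.card) (j : Fin m) (hj : j ∈ S) :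
    ∃ v : Fin m → W, v j = y ∧ (∀ k, k ∉ S → v k = 0) ∧
      Submodule.span F (Set.range v) = ⊤ := by
  classical
  have hli : LinearIndepOn F id ({y} : Set W) := by
    simpa using hy
  let b := Module.Basis.extend hli
  have hfin : Finite ↑(hli.extend (Set.subset_univ _)) := Module.Finite.finite_basis b
  have : Fintype ↑(hli.extend (Set.subset_univ _)) := Fintype.ofFinite _
  have hcard := Module.finrank_eq_card_basis b
  have hymem : y ∈ hli.extend (Set.subset_univ _) := hli.subset_extend _ rfl
  have hle : Fintype.card ↑(hli.extend (Set.subset_univ _)) ≤ Fintype.card S := by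
    rw [← hcard]; simpa using hS
  obtain ⟨f⟩ := Function.Embedding.nonempty_of_card_le hle
  let g : ↑(hli.extend (Set.subset_univ _)) → Fin m :=
    fun a => ((Equiv.swap (f ⟨y, hymem⟩) ⟨j, hj⟩) (f a) : S)
  have hg : Function.Injective g := by
    intro a c h
    exact f.injective ((Equiv.swap _ _).injective (Subtype.ext h))
  refine ⟨Function.extend g b 0, ?_, ?_, ?_⟩
  · have : g ⟨y, hymem⟩ = j := by simp [g]
    rw [← this, hg.extend_apply]
    simp [b]
  · intro k hk
    rw [Function.extend_apply']
    · rfl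
    · rintro ⟨a, rfl⟩
      exact hk (Subtype.prop _)
  · rw [eq_top_iff, ← b.span_eq]
    apply Submodule.span_mono
    rintro _ ⟨a, rfl⟩
    exact ⟨g a, hg.extend_apply _ _ _⟩

theorem graph_lemma {F V W : Type*} [Field F] [AddCommGroup V] [Module F V]
    [FiniteDimensional F V] [AddCommGroup W] [Module F W] [FiniteDimensional F W]
    {m : ℕ} (A : Submodule F (Fin m → V)) (p : V →ₗ[F] W)
    (hWm : Module.finrank F W < m)
    (hA : Module.finrank F A = m * Module.finrank F W)
    (hinj : ∀ M ∈ A, (∀ i, p (M i) = 0) → M = 0)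
    (hrk : ∀ M ∈ A, Module.finrank F (Submodule.span F (Set.range M)) ≤ Module.finrank F W) :
    ∃ U : Submodule F V, Module.finrank F U = Module.finrank F W ∧
      ∀ M ∈ A, ∀ i, M i ∈ U := by
  classical
  let P : A →ₗ[F] (Fin m → W) := (p.compLeft (Fin m)) ∘ₗ A.subtype
  have hPinj : Function.Injective P := by
    rw [← LinearMap.ker_eq_bot, LinearMap.ker_eq_bot']
    rintro ⟨M, hM⟩ h
    apply Subtype.ext
    exact hinj M hM (fun i => congrFun h i)
  let e : A ≃ₗ[F] (Fin m → W) := LinearEquiv.ofInjectiveOfFinrankEq P hPinj (by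
    rw [hA]; simp [Module.finrank_pi_fintype])
  let s : (Fin m → W) →ₗ[F] (Fin m → V) := A.subtype ∘ₗ e.symm.toLinearMap
  have hsA : ∀ v, s v ∈ A := fun v => (e.symm v).2
  have hps : ∀ v i, p (s v i) = v i := by
    intro v i
    exact congrFun (e.apply_symm_apply v) i
  have hsurj : ∀ M ∈ A, ∃ v, s v = M := by
    intro M hM
    exact ⟨e ⟨M, hM⟩, by simp [s]⟩
  have fact : ∀ v : Fin m → W, Submodule.span F (Set.range v) = ⊤ →
      ∀ x ∈ Submodule.span F (Set.range (s v)), p x = 0 → x = 0 := by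
    intro v hv x hx hpx
    have hmap : (Submodule.span F (Set.range (s v))).map p = ⊤ := by
      rw [Submodule.map_span, ← Set.range_comp, ← hv]
      congr 2
      funext i
      exact hps v i
    have h1 := LinearMap.finrank_range_add_finrank_ker
      (p.domRestrict (Submodule.span F (Set.range (s v))))
    rw [LinearMap.range_domRestrict, hmap, finrank_top] at h1
    have h2 := hrk _ (hsA v)
    have h3 : Module.finrank F (LinearMap.ker
      (p.domRestrict (Submodule.span F (Set.range (s v))))) = 0 := by omega
    rw [Submodule.finrank_eq_zero, LinearMap.ker_eq_bot'] at h3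
    have := h3 ⟨x, hx⟩ hpx
    exact congrArg Subtype.val this
  have fact1 : ∀ v : Fin m → W, Submodule.span F (Set.range v) = ⊤ → ∀ i, v i = 0 →
      s v i = 0 := by
    intro v hv i hi
    exact fact v hv _ (Submodule.subset_span ⟨i, rfl⟩) (by rw [hps, hi])
  have fact2 : ∀ v : Fin m → W, Submodule.span F (Set.range v) = ⊤ → ∀ i j, v i = v j →
      s v i = s v j := by
    intro v hv i j hij
    rw [← sub_eq_zero]
    exact fact v hv _ (Submodule.sub_mem _ (Submodule.subset_span ⟨i, rfl⟩)
      (Submodule.subset_span ⟨j, rfl⟩)) (by rw [map_sub, hps, hps, hij, sub_self])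
  have hcardS : ∀ i : Fin m, Module.finrank F W ≤ (univ.erase i).card := by
    intro i
    rw [Finset.card_erase_of_mem (mem_univ _)]
    simp
    omega
  -- adding a multiple of another row keeps the span
  have addrow : ∀ (v : Fin m → W), Submodule.span F (Set.range v) = ⊤ → ∀ k j, k ≠ j →
      Submodule.span F (Set.range (v + Pi.single j (v k))) = ⊤ := by
    intro v hv k j hkj
    rw [eq_top_iff, ← hv, Submodule.span_le]
    rintro _ ⟨l, rfl⟩
    have hk : v k ∈ Submodule.span F (Set.range (v + Pi.single j (v k))) :=
      Submodule.subset_span ⟨k, by simp [hkj]⟩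
    by_cases hl : l = j
    · subst hl
      have h2 : v l + v k ∈ Submodule.span F (Set.range (v + Pi.single l (v k))) :=
        Submodule.subset_span ⟨l, by simp⟩
      have := Submodule.sub_mem _ h2 hk
      simpa using this
    · exact Submodule.subset_span ⟨l, by simp [hl]⟩
  have diag : ∀ i j, i ≠ j → ∀ y : W, s (Pi.single j y) i = 0 := by
    intro i j hij y
    by_cases hy : y = 0
    · subst hy; simp
    by_cases hk : ∃ k, k ≠ i ∧ k ≠ j
    · obtain ⟨k, hki, hkj⟩ := hk
      obtain ⟨v, hvk, hv0, hvs⟩ := exists_spanning (F := F) y hy (univ.erase i) (hcardS i) k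
        (by simp [hki])
      have hvi : v i = 0 := hv0 i (by simp)
      have h1 := fact1 v hvs i hvi
      have h2 := fact1 _ (addrow v hvs k j hkj) i (by simp [hvi, hij])
      rw [map_add, Pi.add_apply, h1, zero_add, hvk] at h2
      exact h2
    · push Not at hk
      obtain ⟨v, hvk, hv0, hvs⟩ := exists_spanning (F := F) y hy (univ.erase i) (hcardS i) j
        (by simp [hij.symm])
      have hvi : v i = 0 := hv0 i (by simp)
      have : v = Pi.single j y := by
        funext k
        by_cases hkj : k = j
        · subst hkj; simp [hvk]
        · have : k = i := by
            by_contra h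
            exact hkj (hk k h)
          subst this
          simp [hvi, hkj]
      rw [← this]
      exact fact1 v hvs i hvi
  have hs : ∀ v i, s v i = s (Pi.single i (v i)) i := by
    intro v i
    conv_lhs => rw [← Finset.univ_sum_single v]
    rw [map_sum, Finset.sum_apply, Finset.sum_eq_single i]
    · intro j _ hj
      exact diag i j hj.symm _
    · simp
  have same : ∀ i j (x : W), s (Pi.single i x) i = s (Pi.single j x) j := by
    intro i j x
    by_cases hij : i = j
    · subst hij; rfl
    by_cases hx : x = 0
    · subst hx; simp
    obtain ⟨v, hvk, hv0, hvs⟩ := exists_spanning (F := F) x hx (univ.erase j) (hcardS j) i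
        (by simp [hij])
    have hvj : v j = 0 := hv0 j (by simp)
    have h := fact2 _ (addrow v hvs i j hij) i j (by simp [hvj, hij])
    rw [hs _ i, hs _ j] at h
    simpa [hvj, hij, hvk] using h
  let i0 : Fin m := ⟨0, by omega⟩
  let g : W →ₗ[F] V := (LinearMap.proj i0) ∘ₗ s ∘ₗ (LinearMap.single F (fun _ => W) i0)
  have hg : ∀ x, g x = s (Pi.single i0 x) i0 := fun x => rfl
  refine ⟨LinearMap.range g, ?_, ?_⟩
  · apply LinearMap.finrank_range_of_inj
    intro x y hxy
    have := congrArg p hxy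
    rw [hg, hg, hps, hps] at this
    simpa using this
  · intro M hM i
    obtain ⟨v, rfl⟩ := hsurj M hM
    rw [hs, same i i0, ← hg]
    exact ⟨_, rfl⟩

theorem dims_cases {m n R : ℕ} (d : Fin m → ℕ) (hd : ∀ i, d i ≤ n) (hnm : n ≤ m) (hR : R < n)
    (hsum : ∑ i, d i = m * R)
    (hno : ¬ ∃ e : Fin (R+1) → Fin m, Function.Injective e ∧ ∀ k, k.1 + 1 ≤ d (e k)) :
    (∀ i, d i = R) ∨ (m = n ∧ (∀ i, d i = 0 ∨ d i = n) ∧ (univ.filter fun i => d i = n).card = R) := by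
  classical
  have : ∃ k : ℕ, k ≤ R ∧ (univ.filter fun i => k + 1 ≤ d i).card ≤ R - k := by
    by_contra! hc
    apply hno
    have := (Finset.all_card_le_biUnion_card_iff_exists_injective
      (fun k : Fin (R+1) => univ.filter fun i => k.1 + 1 ≤ d i)).1 ?_
    · obtain ⟨e, he, h⟩ := this
      exact ⟨e, he, fun k => by simpa using h k⟩
    · intro T
      rcases T.eq_empty_or_nonempty with rfl | hT
      · simp
      let k0 := T.min' hT
      have h1 : T ⊆ Finset.Ici k0 := fun x hx => by simpa using T.min'_le x hx
      have h2 := Finset.card_le_card h1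
      rw [Fin.card_Ici] at h2
      have h3 := hc k0.1 (by omega)
      have h4 : (univ.filter fun i => k0.1 + 1 ≤ d i).card ≤
        (T.biUnion fun k : Fin (R+1) => univ.filter fun i => k.1 + 1 ≤ d i).card := by
        apply Finset.card_le_card
        intro i hi
        exact Finset.mem_biUnion.2 ⟨k0, T.min'_mem hT, hi⟩
      omega
  obtain ⟨k, hk, hc⟩ := this
  set S := univ.filter fun i => k + 1 ≤ d i with hSdef
  have hb : ∀ i, d i ≤ if k + 1 ≤ d i then n else k := by
    intro i
    split_ifs with h
    · exact hd i
    · omega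
  have hval : ∑ i, (if k + 1 ≤ d i then n else k) = S.card * (n - k) + m * k := by
    have : ∀ i, (if k + 1 ≤ d i then n else k) = (if k + 1 ≤ d i then (n-k) else 0) + k := by
      intro i; split_ifs <;> omega
    simp only [this, Finset.sum_add_distrib, Finset.sum_const, Finset.card_univ, Fintype.card_fin]
    rw [← Finset.sum_filter]
    simp [S]
  have hle : m * R ≤ S.card * (n - k) + m * k := by
    rw [← hsum, ← hval]; exact Finset.sum_le_sum fun i _ => hb i
  obtain ⟨t, rfl⟩ : ∃ t, R = k + t := ⟨R - k, by omega⟩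
  have hc' : S.card ≤ t := by omega
  have h5 : m * t ≤ S.card * (n - k) := by rw [mul_add] at hle; omega
  have h6 : S.card * (n - k) ≤ t * (n - k) := Nat.mul_le_mul_right _ hc'
  rcases Nat.eq_zero_or_pos t with ht | ht
  · subst ht
    left
    have hS0 : S.card = 0 := by omega
    have heq : ∑ i, d i = ∑ i : Fin m, (if k + 1 ≤ d i then n else k) := by
      rw [hval, hS0, hsum]; simp
    have := (Finset.sum_eq_sum_iff_of_le (fun i _ => hb i)).1 heq
    intro i
    have h7 := this i (mem_univ _)
    have h8 : i ∉ S := by rw [Finset.card_eq_zero] at hS0; simp [hS0]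
    have h9 : ¬ (k + 1 ≤ d i) := by simpa [S] using h8
    rw [if_neg h9] at h7
    omega
  · right
    have h7 : m ≤ n - k := by
      have : t * m ≤ t * (n - k) := by rw [mul_comm]; omega
      exact Nat.le_of_mul_le_mul_left this ht
    have hk0 : k = 0 := by omega
    subst hk0
    have hmn : m = n := by omega
    subst hmn
    have hSt : S.card = t := by
      apply le_antisymm hc'
      have : m * t ≤ m * S.card := by rw [mul_comm m S.card]; simpa using h5
      exact Nat.le_of_mul_le_mul_left this (by omega)
    have heq : ∑ i, d i = ∑ i : Fin m, (if 0 + 1 ≤ d i then m else 0) := by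
      rw [hval, hSt, hsum]; simp [mul_comm]
    have := (Finset.sum_eq_sum_iff_of_le (fun i _ => hb i)).1 heq
    have hall : ∀ i, d i = 0 ∨ d i = m := by
      intro i
      have := this i (mem_univ _)
      split_ifs at this <;> omega
    refine ⟨rfl, hall, ?_⟩
    rw [zero_add, ← hSt, hSdef]
    congr 1
    ext i
    have := hall i
    simp
    omega

theorem lead_all_le {F V : Type*} [Field F] [AddCommGroup V] [Module F V]
    [FiniteDimensional F V] {m R : ℕ}
    (A : Submodule F (Fin m → V)) (hRm : R < m)
    (hrk : ∀ M ∈ A, Module.finrank F (Submodule.span F (Set.range M)) ≤ R)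
    (hL : ∀ i, Module.finrank F (rowLead A i) = R) (a b : Fin m) :
    rowLead A a ≤ rowLead A b := by
  classical
  intro v hva
  by_contra hvb
  have hab : a ≠ b := by rintro rfl; exact hvb hva
  have hv0 : v ≠ 0 := by rintro rfl; exact hvb (Submodule.zero_mem _)
  obtain ⟨r, rfl⟩ : ∃ r, R = r + 1 := by
    cases R with
    | zero =>
      have := hL a
      rw [Submodule.finrank_eq_zero] at this
      rw [this] at hva
      exact absurd (by simpa using hva) hv0
    | succ r => exact ⟨r, rfl⟩
  obtain ⟨e, he, he0, hel⟩ : ∃ e : Fin (r+1+1) → Fin m, Function.Injective e ∧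
      e 0 = a ∧ e (Fin.last _) = b := by
    let f : Fin (r+1+1) → Fin m := Fin.castLE (by omega)
    have hf : Function.Injective f := Fin.castLE_injective _
    have hne : f (Fin.last _) ≠ f 0 := fun h => by
      have := hf h
      simp [Fin.ext_iff] at this
    let y := Equiv.swap (f 0) a (f (Fin.last _))
    have hy : a ≠ y := by
      intro h
      have : Equiv.swap (f 0) a (f 0) = Equiv.swap (f 0) a (f (Fin.last _)) := by
        rw [Equiv.swap_apply_left]; exact h
      exact hne ((Equiv.swap _ _).injective this).symm
    refine ⟨fun k => Equiv.swap y b (Equiv.swap (f 0) a (f k)), ?_, ?_, ?_⟩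
    · intro k l h
      exact hf ((Equiv.swap _ _).injective ((Equiv.swap _ _).injective h))
    · simp only [Equiv.swap_apply_left]
      exact Equiv.swap_apply_of_ne_of_ne hy hab
    · exact Equiv.swap_apply_left _ _
  obtain ⟨u, hu, hul⟩ := greedy_li (F := F) (r+1)
    (fun k => if k = 0 then Submodule.span F {v} else rowLead A (e k.castSucc)) (by
      intro k
      by_cases hk : k = 0
      · subst hk; rw [if_pos rfl, finrank_span_singleton hv0]; simp
      · rw [if_neg hk, hL]; omega)
  have hu' : ∀ k, u k ∈ rowLead A (e k.castSucc) := by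
    intro k
    have := hu k
    by_cases hk : k = 0
    · subst hk
      simp only [if_true] at this
      simp only [Fin.castSucc_zero, he0]
      exact (Submodule.span_singleton_le_iff_mem _ _).2 hva this
    · simpa [hk] using this
  have hu0 : u 0 ∉ rowLead A b := by
    intro h
    have h0 := hu 0
    simp only [if_true] at h0
    obtain ⟨c, hc⟩ := Submodule.mem_span_singleton.1 h0
    have hc0 : c ≠ 0 := by
      rintro rfl
      exact hul.ne_zero 0 (by rw [← hc]; simp)
    rw [← hc, Submodule.smul_mem_iff _ hc0] at h
    exact hvb h
  obtain ⟨x, hx, hx'⟩ : ∃ x ∈ rowLead A b, x ∉ Submodule.span F (Set.range u) := by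
    by_contra! hc
    have h1 : rowLead A b ≤ Submodule.span F (Set.range u) := hc
    have h2 := Submodule.eq_of_le_of_finrank_eq h1 (by
      rw [finrank_span_eq_card hul, hL]; simp)
    apply hu0
    rw [h2]
    exact Submodule.subset_span ⟨0, rfl⟩
  obtain ⟨M, hM, hMr⟩ := transversal_rank A e he (Fin.snoc u x : Fin (r+1+1) → V) (by
    intro k
    refine Fin.lastCases ?_ (fun i => ?_) k
    · simpa [hel] using hx
    · simpa using hu' i) (by
    rw [linearIndependent_finSnoc]
    exact ⟨hul, hx'⟩)
  have := hrk M hM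
  simp at hMr
  omega

theorem vanish_of_lead {F V : Type*} [Field F] [AddCommGroup V] [Module F V] {m : ℕ}
    (A : Submodule F (Fin m → V)) (M : Fin m → V) (hM : M ∈ A)
    (h : ∀ i, M i ∈ rowLead A i → M i = 0) : M = 0 := by
  have : ∀ p : ℕ, ∀ i : Fin m, i.1 < p → M i = 0 := by
    intro p
    induction p with
    | zero => intro i hi; omega
    | succ p ih =>
      intro i hi
      apply h
      exact ⟨M, ⟨hM, fun j hj => ih j (by omega)⟩, rfl⟩
  funext i
  exact this m i i.2

theorem classify {F : Type*} [Field F] {m n R : ℕ}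
    (A : Submodule F (Fin m → Fin n → F)) (hnm : n ≤ m) (hR : R < n)
    (hA : Module.finrank F A = m * R)
    (hrk : ∀ M ∈ A, Module.finrank F (Submodule.span F (Set.range M)) ≤ R) :
    (∃ U : Submodule F (Fin n → F), Module.finrank F U = R ∧ ∀ M ∈ A, ∀ i, M i ∈ U) ∨
    (m = n ∧ ∃ U : Submodule F (Fin m → F), Module.finrank F U = R ∧
      ∀ M ∈ A, ∀ j, (fun i => M i j) ∈ U) := by
  classical
  have hd := dims_cases (m := m) (n := n) (R := R)
    (fun i => Module.finrank F (rowLead A i))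
    (fun i => (Submodule.finrank_le _).trans (by simp)) hnm hR
    (by rw [← finrank_rowLead, hA]) (by
      rintro ⟨e, he, h⟩
      obtain ⟨u, hu, hul⟩ := greedy_li (R+1) (fun k => rowLead A (e k)) h
      obtain ⟨M, hM, hMr⟩ := transversal_rank A e he u hu hul
      have := hrk M hM
      simp at hMr
      omega)
  rcases hd with h | ⟨hmn, hd, hc⟩
  · left
    let i0 : Fin m := ⟨0, by omega⟩
    have hall : ∀ i, rowLead A i = rowLead A i0 := fun i => le_antisymm
      (lead_all_le A (by omega) hrk h i i0) (lead_all_le A (by omega) hrk h i0 i)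
    obtain ⟨K, hK⟩ := Submodule.exists_isCompl (rowLead A i0)
    have hW : Module.finrank F ((Fin n → F) ⧸ K) = R := by
      rw [← h i0]
      exact (Submodule.quotientEquivOfIsCompl K _ hK.symm).finrank_eq
    have := graph_lemma A K.mkQ (by omega) (by rw [hA, hW]) (by
      intro M hM hz
      apply vanish_of_lead A M hM
      intro i hi
      rw [hall i] at hi
      have h2 : M i ∈ K := by simpa using hz i
      exact (Submodule.disjoint_def.1 hK.disjoint) _ hi h2) (by rw [hW]; exact hrk)
    rw [hW] at this
    exact this
  · right
    refine ⟨hmn, ?_⟩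
    let T := {i : Fin m // Module.finrank F (rowLead A i) = n}
    have hT : Module.finrank F (T → F) = R := by
      rw [Module.finrank_fintype_fun_eq_card, Fintype.card_subtype]; exact hc
    let tr : (Fin m → Fin n → F) ≃ₗ[F] (Fin n → Fin m → F) :=
      Matrix.transposeLinearEquiv (Fin m) (Fin n) F F
    have := graph_lemma (A.map tr.toLinearMap)
      (LinearMap.funLeft F F (Subtype.val : T → Fin m)) (hT.trans_lt hR)
      (by rw [hT, LinearEquiv.finrank_map_eq, hA, hmn]) (by
      rintro _ ⟨M, hM, rfl⟩ hz
      have : M = 0 := by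
        apply vanish_of_lead A M hM
        intro i hi
        rcases hd i with h0 | h1
        · rw [Submodule.finrank_eq_zero] at h0
          rw [h0] at hi
          simpa using hi
        · funext j
          exact congrFun (hz j) ⟨i, h1⟩
      rw [this, map_zero]) (by
      rintro _ ⟨M, hM, rfl⟩
      rw [hT]
      have h1 := hrk M hM
      let N : Matrix (Fin m) (Fin n) F := M
      have h2 := Matrix.rank_eq_finrank_span_row N
      have h3 := Matrix.rank_eq_finrank_span_row Nᵀ
      rw [Matrix.rank_transpose N] at h3
      have h4 : Module.finrank F (Submodule.span F (Set.range (Matrix.row Nᵀ)))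
        ≤ R := by
        rw [← h3, h2]; exact h1
      exact h4)
    rw [hT] at this
    obtain ⟨U, hU, hUA⟩ := this
    refine ⟨U, hU, fun M hM j => ?_⟩
    exact hUA _ ⟨M, hM, rfl⟩ j

theorem finrank_pi_sub {F ι : Type*} [Field F] [Fintype ι] {V : ι → Type*}
    [∀ i, AddCommGroup (V i)] [∀ i, Module F (V i)] [∀ i, FiniteDimensional F (V i)]
    (A : ∀ i, Submodule F (V i)) :
    Module.finrank F (Submodule.pi Set.univ A) = ∑ i, Module.finrank F (A i) := by
  rw [← Module.finrank_pi_fintype]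
  refine LinearEquiv.finrank_eq
    { toFun := fun x i => ⟨x.1 i, x.2 i (Set.mem_univ _)⟩
      invFun := fun y => ⟨fun i => (y i).1, fun i _ => (y i).2⟩
      map_add' := fun _ _ => rfl
      map_smul' := fun _ _ => rfl
      left_inv := fun _ => rfl
      right_inv := fun _ => rfl }

/-- matrices with rows in `U` -/
def rowSp {F : Type*} [Field F] (m : ℕ) {n : ℕ} (U : Submodule F (Fin n → F)) :
    Submodule F (Matrix (Fin m) (Fin n) F) :=
  (Submodule.pi Set.univ (fun _ : Fin m => U) : Submodule F (Fin m → Fin n → F))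

theorem mem_rowSp {F : Type*} [Field F] {m n : ℕ} (U : Submodule F (Fin n → F))
    (M : Matrix (Fin m) (Fin n) F) : M ∈ rowSp m U ↔ ∀ i, M i ∈ U :=
  ⟨fun h i => h i (Set.mem_univ _), fun h i _ => h i⟩

/-- matrices with columns in `U` -/
def colSp {F : Type*} [Field F] {m : ℕ} (n : ℕ) (U : Submodule F (Fin m → F)) :
    Submodule F (Matrix (Fin m) (Fin n) F) :=
  (rowSp n U).map (Matrix.transposeLinearEquiv (Fin n) (Fin m) F F).toLinearMap

theorem mem_colSp {F : Type*} [Field F] {m n : ℕ} (U : Submodule F (Fin m → F))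
    (M : Matrix (Fin m) (Fin n) F) : M ∈ colSp n U ↔ ∀ j, (fun i => M i j) ∈ U := by
  constructor
  · rintro ⟨N, hN, rfl⟩ j
    exact (mem_rowSp U N).1 hN j
  · intro h
    exact ⟨Mᵀ, (mem_rowSp U _).2 h, by ext; rfl⟩

theorem finrank_rowSp {F : Type*} [Field F] {m n : ℕ} (U : Submodule F (Fin n → F)) :
    Module.finrank F (rowSp m U) = m * Module.finrank F U := by
  have := finrank_pi_sub (fun _ : Fin m => U)
  simp only [Finset.sum_const, Finset.card_univ, Fintype.card_fin, smul_eq_mul] at this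
  exact this

theorem finrank_colSp {F : Type*} [Field F] {m n : ℕ} (U : Submodule F (Fin m → F)) :
    Module.finrank F (colSp n U) = n * Module.finrank F U := by
  rw [← finrank_rowSp]
  exact LinearEquiv.finrank_map_eq _ _

theorem rank_le_rowSp {F : Type*} [Field F] {m n : ℕ} (U : Submodule F (Fin n → F))
    (M : Matrix (Fin m) (Fin n) F) (hM : M ∈ rowSp m U) : M.rank ≤ Module.finrank F U := by
  rw [Matrix.rank_eq_finrank_span_row]
  apply Submodule.finrank_mono
  rw [Submodule.span_le]
  rintro _ ⟨i, rfl⟩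
  exact (mem_rowSp U M).1 hM i

theorem exists_rank_rowSp {F : Type*} [Field F] {m n : ℕ} (U : Submodule F (Fin n → F))
    (hU : Module.finrank F U ≤ m) :
    ∃ M ∈ rowSp m U, M.rank = Module.finrank F U := by
  let b := Module.finBasis F U
  let f : Fin (Module.finrank F U) → Fin m := Fin.castLE hU
  have hf : Function.Injective f := Fin.castLE_injective _
  let M : Matrix (Fin m) (Fin n) F := fun i => ((Function.extend f b 0 i : U) : Fin n → F)
  have hM : M ∈ rowSp m U := (mem_rowSp U M).2 fun i => Subtype.prop _
  refine ⟨M, hM, le_antisymm (rank_le_rowSp U M hM) ?_⟩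
  rw [Matrix.rank_eq_finrank_span_row]
  apply Submodule.finrank_mono
  have h1 : Submodule.map U.subtype ⊤ = U := by simp
  rw [← h1, ← b.span_eq, Submodule.map_span]
  apply Submodule.span_mono
  rintro _ ⟨_, ⟨k, rfl⟩, rfl⟩
  refine ⟨f k, ?_⟩
  show ((Function.extend f b 0 (f k) : U) : Fin n → F) = _
  rw [hf.extend_apply]
  rfl

/-- optimal rank anticode of level `R` -/
def Lev {F : Type*} [Field F] [Fintype F] {m n : ℕ}
    (A : Submodule F (Matrix (Fin m) (Fin n) F)) (R : ℕ) : Prop :=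
  IsOptRkAnticode A ∧ sSup {r | ∃ M ∈ A, (M : Matrix (Fin m) (Fin n) F).rank = r} = R

section
variable {F : Type*} [Field F] [Fintype F] {m n : ℕ}

theorem bdd_rank (A : Submodule F (Matrix (Fin m) (Fin n) F)) :
    BddAbove {r | ∃ M ∈ A, (M : Matrix (Fin m) (Fin n) F).rank = r} := by
  refine ⟨n, ?_⟩
  rintro _ ⟨M, _, rfl⟩
  exact Matrix.rank_le_width M

theorem sSup_rank_eq (A : Submodule F (Matrix (Fin m) (Fin n) F)) (R : ℕ)
    (h1 : ∀ M ∈ A, M.rank ≤ R) (h2 : ∃ M ∈ A, M.rank = R) :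
    sSup {r | ∃ M ∈ A, (M : Matrix (Fin m) (Fin n) F).rank = r} = R := by
  apply IsGreatest.csSup_eq
  exact ⟨h2, by rintro _ ⟨M, hM, rfl⟩; exact h1 M hM⟩

theorem Lev.rank_le {A : Submodule F (Matrix (Fin m) (Fin n) F)} {R : ℕ} (h : Lev A R)
    (M : Matrix (Fin m) (Fin n) F) (hM : M ∈ A) : M.rank ≤ R := by
  rw [← h.2]
  exact le_csSup (bdd_rank A) ⟨M, hM, rfl⟩

theorem Lev.exists_rank {A : Submodule F (Matrix (Fin m) (Fin n) F)} {R : ℕ} (h : Lev A R) :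
    ∃ M ∈ A, M.rank = R := by
  have := Nat.sSup_mem (s := {r | ∃ M ∈ A, (M : Matrix (Fin m) (Fin n) F).rank = r})
    ⟨_, 0, A.zero_mem, rfl⟩ (bdd_rank A)
  rw [h.2] at this
  exact this

theorem Lev.le {A : Submodule F (Matrix (Fin m) (Fin n) F)} {R : ℕ} (h : Lev A R) : R ≤ n := by
  obtain ⟨M, _, rfl⟩ := h.exists_rank
  exact Matrix.rank_le_width M

theorem Lev.finrank {A : Submodule F (Matrix (Fin m) (Fin n) F)} {R : ℕ} (h : Lev A R) :
    Module.finrank F A = m * R := by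
  have := h.1
  unfold IsOptRkAnticode at this
  rw [this, h.2]

theorem lev_row (hnm : n ≤ m) (U : Submodule F (Fin n → F)) :
    Lev (rowSp m U) (Module.finrank F U) := by
  have hU : Module.finrank F U ≤ m := ((Submodule.finrank_le U).trans (by simp)).trans hnm
  have := sSup_rank_eq (rowSp m U) _ (rank_le_rowSp U) (exists_rank_rowSp U hU)
  exact ⟨by unfold IsOptRkAnticode; rw [this, finrank_rowSp], this⟩

theorem lev_col (hnm : m = n) (U : Submodule F (Fin m → F)) :
    Lev (colSp n U) (Module.finrank F U) := by
  have hU : Module.finrank F U ≤ n := (Submodule.finrank_le U).trans (by simp [hnm])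
  have := sSup_rank_eq (colSp n U) (Module.finrank F U) (by
    rintro _ ⟨N, hN, rfl⟩
    have := rank_le_rowSp U N hN
    rw [← Matrix.rank_transpose] at this
    exact this) (by
    obtain ⟨N, hN, h⟩ := exists_rank_rowSp U hU
    exact ⟨Nᵀ, ⟨N, hN, rfl⟩, by rw [Matrix.rank_transpose, h]⟩)
  exact ⟨by unfold IsOptRkAnticode; rw [this, finrank_colSp]; exact congrArg (· * _) hnm.symm, this⟩

theorem Lev.cases {A : Submodule F (Matrix (Fin m) (Fin n) F)} {R : ℕ} (h : Lev A R)
    (hnm : n ≤ m) :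
    (∃ U : Submodule F (Fin n → F), Module.finrank F U = R ∧ A = rowSp m U) ∨
    (m = n ∧ ∃ U : Submodule F (Fin m → F), Module.finrank F U = R ∧ A = colSp n U) := by
  rcases h.le.lt_or_eq with hR | hR
  · rcases classify (F := F) (R := R) A hnm hR h.finrank (fun M hM => by
      have := h.rank_le M hM
      have h2 := Matrix.rank_eq_finrank_span_row (R := F) (m := Fin m) (n := Fin n) M
      rw [h2] at this
      exact this) with ⟨U, hU, hUA⟩ | ⟨hmn, U, hU, hUA⟩
    · left
      refine ⟨U, hU, Submodule.eq_of_le_of_finrank_eq ?_ ?_⟩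
      · intro M hM
        exact (mem_rowSp U M).2 (hUA M hM)
      · rw [h.finrank, finrank_rowSp, hU]
    · right
      refine ⟨hmn, U, hU, Submodule.eq_of_le_of_finrank_eq ?_ ?_⟩
      · intro M hM
        exact (mem_colSp U M).2 (hUA M hM)
      · rw [h.finrank, finrank_colSp, hU, hmn]
  · left
    refine ⟨⊤, by simp [hR], Submodule.eq_of_le_of_finrank_eq ?_ ?_⟩
    · intro M _
      exact (mem_rowSp _ M).2 fun _ => trivial
    · rw [h.finrank, finrank_rowSp]; simp [hR]

theorem exists_dot_orth {F : Type*} [Field F] {n : ℕ} (U : Submodule F (Fin n → F)) :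
    ∃ U' : Submodule F (Fin n → F), Module.finrank F U' = n - Module.finrank F U ∧
      ∀ x ∈ U', ∀ y ∈ U, x ⬝ᵥ y = 0 := by
  let e := dotProductEquiv F (Fin n)
  refine ⟨U.dualAnnihilator.comap e.toLinearMap, ?_, ?_⟩
  · have h1 : Module.finrank F (U.dualAnnihilator.comap e.toLinearMap) =
        Module.finrank F U.dualAnnihilator := by
      rw [Submodule.comap_equiv_eq_map_symm]
      exact LinearEquiv.finrank_map_eq _ _
    have h2 := Subspace.finrank_add_finrank_dualAnnihilator_eq U
    simp at h2
    omega
  · intro x hx y hy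
    exact (Submodule.mem_dualAnnihilator _).1 hx y hy

theorem Lev.dual {A : Submodule F (Matrix (Fin m) (Fin n) F)} {R : ℕ} (h : Lev A R)
    (hnm : n ≤ m) :
    ∃ A' : Submodule F (Matrix (Fin m) (Fin n) F), Lev A' (n - R) ∧
      ∀ D ∈ A', ∀ C ∈ A, Matrix.trace (D * Cᵀ) = 0 := by
  rcases h.cases hnm with ⟨U, hU, rfl⟩ | ⟨hmn, U, hU, rfl⟩
  · obtain ⟨U', hU', ho⟩ := exists_dot_orth U
    refine ⟨rowSp m U', ?_, ?_⟩
    · rw [← hU, ← hU']; exact lev_row hnm U'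
    · intro D hD C hC
      rw [Matrix.trace]
      apply Finset.sum_eq_zero
      intro i _
      exact ho _ ((mem_rowSp _ D).1 hD i) _ ((mem_rowSp _ C).1 hC i)
  · obtain ⟨U', hU', ho⟩ := exists_dot_orth U
    refine ⟨colSp n U', ?_, ?_⟩
    · rw [← hmn, ← hU, ← hU']; subst hmn; exact lev_col rfl U'
    · intro D hD C hC
      rw [Matrix.trace_mul_comm, Matrix.trace]
      apply Finset.sum_eq_zero
      intro j _
      have := ho _ ((mem_colSp _ D).1 hD j) _ ((mem_colSp _ C).1 hC j)
      rw [dotProduct_comm] at this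
      exact this

theorem exists_sub_finrank {F V : Type*} [Field F] [AddCommGroup V] [Module F V]
    [FiniteDimensional F V] (U : Submodule F V) (hU : 1 ≤ Module.finrank F U) :
    ∃ U' ≤ U, Module.finrank F U' = Module.finrank F U - 1 := by
  obtain ⟨k, hk⟩ : ∃ k, Module.finrank F U = k + 1 := ⟨_, (Nat.sub_add_cancel hU).symm⟩
  let b := Module.finBasisOfFinrankEq F U hk
  have hli : LinearIndependent F (fun i : Fin k => ((b i.castSucc : U) : V)) := by
    have := (b.linearIndependent.map' U.subtype (by simp)).comp _ (Fin.castSucc_injective k)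
    exact this
  refine ⟨Submodule.span F (Set.range (fun i : Fin k => ((b i.castSucc : U) : V))), ?_, ?_⟩
  · rw [Submodule.span_le]
    rintro _ ⟨i, rfl⟩
    exact Subtype.prop _
  · rw [finrank_span_eq_card hli]
    simp; omega

theorem Lev.shrink {A : Submodule F (Matrix (Fin m) (Fin n) F)} {R : ℕ} (h : Lev A R)
    (hnm : n ≤ m) (hR : 1 ≤ R) : ∃ A' ≤ A, Lev A' (R - 1) := by
  rcases h.cases hnm with ⟨U, hU, rfl⟩ | ⟨hmn, U, hU, rfl⟩
  · obtain ⟨U', hle, hU'⟩ := exists_sub_finrank U (by omega)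
    refine ⟨rowSp m U', ?_, ?_⟩
    · intro M hM
      exact (mem_rowSp _ _).2 fun i => hle ((mem_rowSp _ _).1 hM i)
    · rw [← hU, ← hU']; exact lev_row hnm U'
  · obtain ⟨U', hle, hU'⟩ := exists_sub_finrank U (by omega)
    refine ⟨colSp n U', ?_, ?_⟩
    · intro M hM
      exact (mem_colSp _ _).2 fun i => hle ((mem_colSp _ _).1 hM i)
    · rw [← hU, ← hU']; exact lev_col hmn U'

theorem lev_top (hnm : n ≤ m) : Lev (⊤ : Submodule F (Matrix (Fin m) (Fin n) F)) n := by
  have h := lev_row (F := F) hnm (⊤ : Submodule F (Fin n → F))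
  have h2 : rowSp m (⊤ : Submodule F (Fin n → F)) = ⊤ := by
    rw [eq_top_iff]; intro M _; exact (mem_rowSp _ M).2 fun _ => trivial
  rw [h2] at h
  simpa using h

end

theorem wei_arith (n m k K r : ℕ) (hm : 0 < m) (f g wf wg : ℕ → ℕ)
    (hf0 : f 0 = 0) (hfn : f n = k) (hfm : ∀ a b, a ≤ b → b ≤ n → f a ≤ f b)
    (hfs : ∀ a, a < n → f (a+1) ≤ f a + m)
    (hg0 : g 0 = 0) (hgn : g n = K) (hgm : ∀ a b, a ≤ b → b ≤ n → g a ≤ g b)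
    (hdual : ∀ a, a ≤ n → g a + k = m * a + f (n - a))
    (hwf : ∀ t a, 1 ≤ t → t ≤ k → a ≤ n → (wf t ≤ a ↔ t ≤ f a))
    (hwg : ∀ t a, 1 ≤ t → t ≤ K → a ≤ n → (wg t ≤ a ↔ t ≤ g a)) :
    {w : ℕ | ∃ s : ℤ, 1 ≤ (r:ℤ) + s * m ∧ (r:ℤ) + s * m ≤ K ∧ w = wg ((r:ℤ) + s * m).toNat} =
    Set.Icc 1 n \ {w : ℕ | ∃ s : ℤ, 1 ≤ ((r:ℤ) + k) + s * m ∧ ((r:ℤ) + k) + s * m ≤ k ∧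
      w = n + 1 - wf (((r:ℤ) + k) + s * m).toNat} := by
  ext w
  simp only [Set.mem_ofPred_eq, Set.mem_sdiff, Set.mem_Icc]
  constructor
  · rintro ⟨s, h1, h2, hw⟩
    obtain ⟨t, ht⟩ : ∃ t : ℕ, (r:ℤ) + s * m = t := ⟨_, (Int.toNat_of_nonneg (by omega)).symm⟩
    rw [ht] at hw h1 h2
    rw [Int.toNat_natCast] at hw
    have h1 : 1 ≤ t := by omega
    have h2 : t ≤ K := by omega
    have hw1 : 1 ≤ w := by
      have := hwg t 0 h1 h2 (by omega)
      omega
    have hwn : w ≤ n := by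
      have := hwg t n h1 h2 le_rfl
      omega
    refine ⟨⟨hw1, hwn⟩, ?_⟩
    rintro ⟨s', h3, h4, hw'⟩
    obtain ⟨t', ht'⟩ : ∃ t : ℕ, (r:ℤ) + k + s' * m = t :=
      ⟨_, (Int.toNat_of_nonneg (by omega)).symm⟩
    rw [ht'] at hw' h3 h4
    rw [Int.toNat_natCast] at hw'
    have h3 : 1 ≤ t' := by omega
    have h4 : t' ≤ k := by omega
    have e1 := hwf t' 0 h3 h4 (by omega)
    have e2 := hwf t' n h3 h4 le_rfl
    have e3 : wf t' = n - w + 1 := by omega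
    have e4 := hwf t' (n-w) h3 h4 (by omega)
    have e5 := hwf t' (n-w+1) h3 h4 (by omega)
    have e6 := hwg t w h1 h2 hwn
    have e7 := hwg t (w-1) h1 h2 (by omega)
    have e8 := hdual w hwn
    have e9 := hdual (w-1) (by omega)
    have e10 : n - (w-1) = n - w + 1 := by omega
    rw [e10] at e9
    obtain ⟨v, rfl⟩ : ∃ v, w = v + 1 := ⟨w - 1, by omega⟩
    simp only [Nat.add_sub_cancel] at e9 e7
    rw [mul_add] at e8
    have q1 : (t:ℤ) + k - m * v - m < t' := by
      have : (m * v : ℕ) = (m:ℤ) * v := by push_cast; ring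
      omega
    have q2 : (t':ℤ) < t + k - m * v := by
      have : (m * v : ℕ) = (m:ℤ) * v := by push_cast; ring
      omega
    rw [← ht, ← ht'] at q1 q2
    have hm' : (0:ℤ) < m := by exact_mod_cast hm
    have q3 : (m:ℤ) * (s - v - 1) < m * s' := by linarith
    have q4 : (m:ℤ) * s' < m * (s - v) := by linarith
    have q5 := lt_of_mul_lt_mul_left q3 hm'.le
    have q6 := lt_of_mul_lt_mul_left q4 hm'.le
    omega
  · rintro ⟨⟨hw1, hwn⟩, hno⟩
    obtain ⟨v, rfl⟩ : ∃ v, w = v + 1 := ⟨w - 1, by omega⟩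
    have e8 := hdual (v+1) hwn
    have e9 := hdual v (by omega)
    have e10 : n - v = n - (v+1) + 1 := by omega
    have hm' : (0:ℤ) < m := by exact_mod_cast hm
    set x := f (n - (v+1)) with hx
    set y := f (n - v) with hy
    have hyx : y ≤ x + m := by rw [hy, e10]; exact hfs _ (by omega)
    have hyk : y ≤ k := by rw [← hfn]; exact hfm _ _ (by omega) le_rfl
    -- the representative
    obtain ⟨s', hs1, hs2⟩ : ∃ s' : ℤ, (x:ℤ) < r + k + s' * m ∧ r + k + s' * m ≤ (x:ℤ) + m := by
      refine ⟨(x + m - r - k) / m, ?_, ?_⟩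
      · have a1 := Int.emod_add_mul_ediv ((x:ℤ) + m - r - k) m
        have a2 := Int.emod_lt_of_pos ((x:ℤ) + m - r - k) hm'
        rw [mul_comm] at a1
        linarith
      · have a1 := Int.emod_add_mul_ediv ((x:ℤ) + m - r - k) m
        have a2 := Int.emod_nonneg ((x:ℤ) + m - r - k) hm'.ne'
        rw [mul_comm] at a1
        linarith
    have hs3 : (y:ℤ) < r + k + s' * m := by
      by_contra! hc
      apply hno
      refine ⟨s', by omega, by omega, ?_⟩
      obtain ⟨t', ht'⟩ : ∃ t : ℕ, (r:ℤ) + k + s' * m = t :=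
        ⟨_, (Int.toNat_of_nonneg (by omega)).symm⟩
      rw [ht'] at hs1 hs2 hc ⊢
      rw [Int.toNat_natCast]
      have b1 := hwf t' (n - (v+1)) (by omega) (by omega) (by omega)
      have b2 := hwf t' (n - v) (by omega) (by omega) (by omega)
      rw [← hx] at b1
      rw [← hy] at b2
      have b3 := b2.2 (by omega)
      have b4 : ¬ wf t' ≤ n - (v+1) := fun h => by have := b1.1 h; omega
      omega
    have hmv : ((m * v : ℕ) : ℤ) = (m:ℤ) * v := by push_cast; ring
    rw [mul_add] at e8
    have hexp : (r:ℤ) + (s' + v) * m = (r + k + s' * m) - k + m * v := by ring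
    have hgK : g (v+1) ≤ K := by rw [← hgn]; exact hgm _ _ hwn le_rfl
    have c1 : (r:ℤ) + (s' + v) * m ≤ g (v+1) := by rw [hexp]; omega
    have c2 : (g v : ℤ) < (r:ℤ) + (s' + v) * m := by rw [hexp]; omega
    refine ⟨s' + v, by omega, by omega, ?_⟩
    obtain ⟨t, ht⟩ : ∃ t : ℕ, (r:ℤ) + (s' + v) * m = t :=
      ⟨_, (Int.toNat_of_nonneg (by omega)).symm⟩
    rw [ht] at c1 c2 ⊢
    rw [Int.toNat_natCast]
    have b1 := hwg t v (by omega) (by omega) (by omega)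
    have b2 := hwg t (v+1) (by omega) (by omega) (by omega)
    have b3 := b2.2 (by omega)
    have b4 : ¬ wg t ≤ v := fun h => by have := b1.1 h; omega
    omega

section
variable {F : Type*} [Field F] [Fintype F] {ℓ mm : ℕ} {n : Fin ℓ → ℕ}

/-- product of optimal anticodes of total level `a` -/
def Prd (B : Submodule F (∀ i : Fin ℓ, Matrix (Fin mm) (Fin (n i)) F)) (a : ℕ) : Prop :=
  ∃ (A : ∀ i : Fin ℓ, Submodule F (Matrix (Fin mm) (Fin (n i)) F)) (R : Fin ℓ → ℕ),
    (∀ i, Lev (A i) (R i)) ∧ B = Submodule.pi Set.univ A ∧ ∑ i, R i = a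

theorem Prd.finrank {B : Submodule F (∀ i : Fin ℓ, Matrix (Fin mm) (Fin (n i)) F)} {a : ℕ}
    (h : Prd B a) : Module.finrank F B = mm * a := by
  obtain ⟨A, R, hA, rfl, rfl⟩ := h
  rw [finrank_pi_sub, Finset.mul_sum]
  exact Finset.sum_congr rfl fun i _ => (hA i).finrank

theorem Prd.le {B : Submodule F (∀ i : Fin ℓ, Matrix (Fin mm) (Fin (n i)) F)} {a : ℕ}
    (h : Prd B a) : a ≤ ∑ i, n i := by
  obtain ⟨A, R, hA, rfl, rfl⟩ := h
  exact Finset.sum_le_sum fun i _ => (hA i).le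

theorem prd_top (hnm : ∀ i, n i ≤ mm) :
    Prd (⊤ : Submodule F (∀ i : Fin ℓ, Matrix (Fin mm) (Fin (n i)) F)) (∑ i, n i) :=
  ⟨fun _ => ⊤, n, fun i => lev_top (hnm i), by simp, rfl⟩

theorem Prd.shrink {B : Submodule F (∀ i : Fin ℓ, Matrix (Fin mm) (Fin (n i)) F)} {a : ℕ}
    (h : Prd B a) (hnm : ∀ i, n i ≤ mm) (ha : 1 ≤ a) : ∃ B' ≤ B, Prd B' (a - 1) := by
  classical
  obtain ⟨A, R, hA, rfl, rfl⟩ := h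
  obtain ⟨j, hj⟩ : ∃ j, 1 ≤ R j := by
    by_contra! hc
    have : ∑ i, R i = 0 := Finset.sum_eq_zero fun i _ => by have := hc i; omega
    omega
  obtain ⟨A', hle, hA'⟩ := (hA j).shrink (hnm j) hj
  refine ⟨Submodule.pi Set.univ (Function.update A j A'), ?_, Function.update A j A',
    Function.update R j (R j - 1), ?_, rfl, ?_⟩
  · intro x hx i hi
    have this : x i ∈ Function.update A j A' i := hx i hi
    show x i ∈ A i
    by_cases h : i = j
    · subst h
      rw [Function.update_self] at this
      exact hle this
    · rwa [Function.update_of_ne h] at this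
  · intro i
    by_cases h : i = j
    · subst h
      simpa using hA'
    · simpa [h] using hA i
  · rw [Finset.sum_update_of_mem (Finset.mem_univ j)]
    have := Finset.add_sum_erase Finset.univ R (Finset.mem_univ j)
    rw [← Finset.erase_eq]
    omega

/-- trace pairing -/
noncomputable def trPair (ℓ mm : ℕ) (n : Fin ℓ → ℕ) (F : Type*) [Field F] :
    (∀ i : Fin ℓ, Matrix (Fin mm) (Fin (n i)) F) →ₗ[F]
    (∀ i : Fin ℓ, Matrix (Fin mm) (Fin (n i)) F) →ₗ[F] F :=
  LinearMap.mk₂ F (fun D C => ∑ i, Matrix.trace (D i * (C i)ᵀ))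
    (by intros; simp [Matrix.add_mul, Finset.sum_add_distrib])
    (by intros; simp [Finset.mul_sum])
    (by intros; simp [Matrix.mul_add, Finset.sum_add_distrib])
    (by intros; simp [Finset.mul_sum])

theorem trPair_apply (D C : ∀ i : Fin ℓ, Matrix (Fin mm) (Fin (n i)) F) :
    trPair ℓ mm n F D C = ∑ i, Matrix.trace (D i * (C i)ᵀ) := rfl

theorem trPair_symm (D C : ∀ i : Fin ℓ, Matrix (Fin mm) (Fin (n i)) F) :
    trPair ℓ mm n F D C = trPair ℓ mm n F C D := by
  rw [trPair_apply, trPair_apply]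
  refine Finset.sum_congr rfl fun i _ => ?_
  rw [← Matrix.trace_transpose, Matrix.transpose_mul, Matrix.transpose_transpose]

theorem trPair_inj : Function.Injective (trPair ℓ mm n F) := by
  classical
  rw [← LinearMap.ker_eq_bot, LinearMap.ker_eq_bot']
  intro D hD
  funext i
  ext a b
  have h := LinearMap.congr_fun hD (Pi.single i (Matrix.single a b 1))
  rw [trPair_apply, Finset.sum_eq_single i] at h
  · simpa [Matrix.transpose_single, Matrix.trace_mul_single] using h
  · intro j _ hj
    simp [hj]
  · simp

theorem mem_dualCode (C : Submodule F (∀ i : Fin ℓ, Matrix (Fin mm) (Fin (n i)) F))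
    (D : ∀ i : Fin ℓ, Matrix (Fin mm) (Fin (n i)) F) :
    D ∈ dualCode C ↔ ∀ x ∈ C, trPair ℓ mm n F D x = 0 := Iff.rfl

theorem finrank_total :
    Module.finrank F (∀ i : Fin ℓ, Matrix (Fin mm) (Fin (n i)) F) = mm * ∑ i, n i := by
  rw [Module.finrank_pi_fintype, Finset.mul_sum]
  refine Finset.sum_congr rfl fun i _ => ?_
  rw [Module.finrank_matrix]
  simp

theorem finrank_dualCode (C : Submodule F (∀ i : Fin ℓ, Matrix (Fin mm) (Fin (n i)) F)) :
    Module.finrank F C + Module.finrank F (dualCode C) = mm * ∑ i, n i := by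
  let e := LinearEquiv.ofInjectiveOfFinrankEq (trPair ℓ mm n F) trPair_inj
    (Subspace.dual_finrank_eq (K := F)
      (V := ∀ i : Fin ℓ, Matrix (Fin mm) (Fin (n i)) F)).symm
  have h1 : dualCode C = C.dualAnnihilator.comap e.toLinearMap := by
    ext D
    rw [mem_dualCode, Submodule.mem_comap, Submodule.mem_dualAnnihilator]
    rfl
  have h2 : Module.finrank F (dualCode C) = Module.finrank F C.dualAnnihilator := by
    rw [h1, Submodule.comap_equiv_eq_map_symm]
    exact LinearEquiv.finrank_map_eq _ _
  have h3 := Subspace.finrank_add_finrank_dualAnnihilator_eq C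
  rw [h2, h3, finrank_total]

theorem dual_dual (C : Submodule F (∀ i : Fin ℓ, Matrix (Fin mm) (Fin (n i)) F)) :
    dualCode (dualCode C) = C := by
  symm
  apply Submodule.eq_of_le_of_finrank_eq
  · intro x hx
    rw [mem_dualCode]
    intro y hy
    rw [trPair_symm]
    exact hy x hx
  · have h1 := finrank_dualCode C
    have h2 := finrank_dualCode (dualCode C)
    omega

theorem dual_anti {C D : Submodule F (∀ i : Fin ℓ, Matrix (Fin mm) (Fin (n i)) F)}
    (h : C ≤ D) : dualCode D ≤ dualCode C := fun _ hx y hy => hx y (h hy)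

theorem dual_sup (C D : Submodule F (∀ i : Fin ℓ, Matrix (Fin mm) (Fin (n i)) F)) :
    dualCode (C ⊔ D) = dualCode C ⊓ dualCode D := by
  apply le_antisymm
  · exact le_inf (dual_anti le_sup_left) (dual_anti le_sup_right)
  · rintro x ⟨h1, h2⟩
    rw [mem_dualCode]
    intro y hy
    obtain ⟨c, hc, d, hd, rfl⟩ := Submodule.mem_sup.1 hy
    have e1 : trPair ℓ mm n F x c = 0 := h1 c hc
    have e2 : trPair ℓ mm n F x d = 0 := h2 d hd
    rw [map_add, e1, e2, add_zero]

theorem Prd.dual {B : Submodule F (∀ i : Fin ℓ, Matrix (Fin mm) (Fin (n i)) F)} {a : ℕ}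
    (h : Prd B a) (hnm : ∀ i, n i ≤ mm) : Prd (dualCode B) (∑ i, n i - a) := by
  have hB := h.finrank
  have ha := h.le
  obtain ⟨A, R, hA, rfl, rfl⟩ := h
  choose A' hA' ho using fun i => (hA i).dual (hnm i)
  have hs : ∑ i, (n i - R i) = ∑ i, n i - ∑ i, R i :=
    Finset.sum_tsub_distrib _ fun i _ => (hA i).le
  refine ⟨A', fun i => n i - R i, hA', ?_, hs⟩
  symm
  apply Submodule.eq_of_le_of_finrank_eq
  · intro x hx y hy
    apply Finset.sum_eq_zero
    intro i _
    exact ho i _ (hx i (Set.mem_univ _)) _ (hy i (Set.mem_univ _))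
  · have h1 := finrank_dualCode (Submodule.pi Set.univ A)
    have h2 : Prd (Submodule.pi Set.univ A') (∑ i, n i - ∑ i, R i) := ⟨A', _, hA', rfl, hs⟩
    rw [h2.finrank, Nat.mul_sub]
    omega

theorem Prd.grow {B : Submodule F (∀ i : Fin ℓ, Matrix (Fin mm) (Fin (n i)) F)} {a : ℕ}
    (h : Prd B a) (hnm : ∀ i, n i ≤ mm) (ha : a < ∑ i, n i) : ∃ B' ≥ B, Prd B' (a + 1) := by
  obtain ⟨B', hle, hB'⟩ := (h.dual hnm).shrink hnm (by omega)
  refine ⟨dualCode B', ?_, ?_⟩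
  · have := dual_anti hle
    rwa [dual_dual] at this
  · have := hB'.dual hnm
    have e : ∑ i, n i - (∑ i, n i - a - 1) = a + 1 := by omega
    rwa [e] at this

theorem exists_prd (F : Type*) [Field F] [Fintype F] (hnm : ∀ i, n i ≤ mm) (a : ℕ)
    (ha : a ≤ ∑ i, n i) :
    ∃ B : Submodule F (∀ i : Fin ℓ, Matrix (Fin mm) (Fin (n i)) F), Prd B a := by
  have : ∀ b ≤ ∑ i, n i, ∃ B : Submodule F (∀ i : Fin ℓ, Matrix (Fin mm) (Fin (n i)) F),
      Prd B (∑ i, n i - b) := by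
    intro b
    induction b with
    | zero => intro _; exact ⟨⊤, prd_top hnm⟩
    | succ b ih =>
      intro hb
      obtain ⟨B, hB⟩ := ih (by omega)
      obtain ⟨B', _, hB'⟩ := hB.shrink hnm (by omega)
      exact ⟨B', by rwa [Nat.sub_sub] at hB'⟩
  obtain ⟨B, hB⟩ := this (∑ i, n i - a) (by omega)
  exact ⟨B, by rwa [Nat.sub_sub_self ha] at hB⟩

/-- largest intersection with a product anticode of level `a` -/
noncomputable def fmax (C : Submodule F (∀ i : Fin ℓ, Matrix (Fin mm) (Fin (n i)) F)) (a : ℕ) : ℕ :=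
  sSup {t | ∃ B, Prd B a ∧ t = Module.finrank F ↥(C ⊓ B)}

theorem fmax_bdd (C : Submodule F (∀ i : Fin ℓ, Matrix (Fin mm) (Fin (n i)) F)) (a : ℕ) :
    BddAbove {t | ∃ B, Prd B a ∧ t = Module.finrank F ↥(C ⊓ B)} := by
  refine ⟨Module.finrank F C, ?_⟩
  rintro _ ⟨B, _, rfl⟩
  exact Submodule.finrank_mono inf_le_left

theorem le_fmax (C : Submodule F (∀ i : Fin ℓ, Matrix (Fin mm) (Fin (n i)) F)) {a : ℕ}
    {B : Submodule F (∀ i : Fin ℓ, Matrix (Fin mm) (Fin (n i)) F)} (h : Prd B a) :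
    Module.finrank F ↥(C ⊓ B) ≤ fmax C a := le_csSup (fmax_bdd C a) ⟨B, h, rfl⟩

theorem fmax_spec (hnm : ∀ i, n i ≤ mm)
    (C : Submodule F (∀ i : Fin ℓ, Matrix (Fin mm) (Fin (n i)) F)) {a : ℕ} (ha : a ≤ ∑ i, n i) :
    ∃ B, Prd B a ∧ fmax C a = Module.finrank F ↥(C ⊓ B) := by
  obtain ⟨B, hB⟩ := exists_prd F hnm a ha
  exact Nat.sSup_mem (s := {t | ∃ B, Prd B a ∧ t = Module.finrank F ↥(C ⊓ B)})
    ⟨_, B, hB, rfl⟩ (fmax_bdd C a)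

theorem fmax_zero (hnm : ∀ i, n i ≤ mm)
    (C : Submodule F (∀ i : Fin ℓ, Matrix (Fin mm) (Fin (n i)) F)) : fmax C 0 = 0 := by
  obtain ⟨B, hB, h⟩ := fmax_spec hnm C (Nat.zero_le _)
  have h1 : Module.finrank F ↥(C ⊓ B) ≤ Module.finrank F B := Submodule.finrank_mono inf_le_right
  rw [hB.finrank] at h1
  omega

theorem fmax_top (hnm : ∀ i, n i ≤ mm)
    (C : Submodule F (∀ i : Fin ℓ, Matrix (Fin mm) (Fin (n i)) F)) :
    fmax C (∑ i, n i) = Module.finrank F C := by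
  apply le_antisymm
  · obtain ⟨B, hB, h⟩ := fmax_spec hnm C (le_refl (∑ i, n i))
    rw [h]
    exact Submodule.finrank_mono inf_le_left
  · have := le_fmax C (prd_top (F := F) hnm)
    rwa [inf_top_eq] at this

theorem fmax_mono (hnm : ∀ i, n i ≤ mm)
    (C : Submodule F (∀ i : Fin ℓ, Matrix (Fin mm) (Fin (n i)) F)) (a b : ℕ) (hab : a ≤ b)
    (hb : b ≤ ∑ i, n i) : fmax C a ≤ fmax C b := by
  induction b, hab using Nat.le_induction with
  | base => exact le_rfl
  | succ b hab ih =>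
    refine (ih (by omega)).trans ?_
    obtain ⟨B, hB, h⟩ := fmax_spec hnm C (show b ≤ ∑ i, n i by omega)
    obtain ⟨B', hle, hB'⟩ := hB.grow hnm (by omega)
    rw [h]
    exact (Submodule.finrank_mono (inf_le_inf_left C hle)).trans (le_fmax C hB')

theorem fmax_dual (hnm : ∀ i, n i ≤ mm)
    (C : Submodule F (∀ i : Fin ℓ, Matrix (Fin mm) (Fin (n i)) F)) (a : ℕ)
    (ha : a ≤ ∑ i, n i) :
    fmax (dualCode C) a + Module.finrank F C = mm * a + fmax C (∑ i, n i - a) := by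
  have key : ∀ (B : Submodule F (∀ i : Fin ℓ, Matrix (Fin mm) (Fin (n i)) F)) (b : ℕ), Prd B b →
      Module.finrank F ↥(dualCode C ⊓ dualCode B) + Module.finrank F C =
        mm * (∑ i, n i - b) + Module.finrank F ↥(C ⊓ B) := by
    intro B b hB
    rw [← dual_sup]
    have h1 := finrank_dualCode (C ⊔ B)
    have h2 := Submodule.finrank_sup_add_finrank_inf_eq C B
    rw [hB.finrank] at h2
    have h3 : mm * (∑ i, n i - b) + mm * b = mm * ∑ i, n i := by
      rw [← Nat.mul_add, Nat.sub_add_cancel hB.le]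
    omega
  apply le_antisymm
  · obtain ⟨B, hB, h⟩ := fmax_spec hnm (dualCode C) ha
    have hB' := hB.dual hnm
    have h1 := key _ _ hB'
    rw [dual_dual, Nat.sub_sub_self ha] at h1
    have h2 := le_fmax C hB'
    omega
  · obtain ⟨B, hB, h⟩ := fmax_spec hnm C (Nat.sub_le (∑ i, n i) a)
    have h1 := key _ _ hB
    have hB' := hB.dual hnm
    rw [Nat.sub_sub_self ha] at h1 hB'
    have h2 := le_fmax (dualCode C) hB'
    omega

theorem fmax_step (hnm : ∀ i, n i ≤ mm)
    (C : Submodule F (∀ i : Fin ℓ, Matrix (Fin mm) (Fin (n i)) F)) (a : ℕ)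
    (ha : a < ∑ i, n i) : fmax C (a + 1) ≤ fmax C a + mm := by
  have h1 := fmax_dual hnm C (∑ i, n i - a) (by omega)
  have h2 := fmax_dual hnm C (∑ i, n i - (a + 1)) (by omega)
  rw [Nat.sub_sub_self (by omega)] at h1 h2
  have h3 := fmax_mono hnm (dualCode C) (∑ i, n i - (a+1)) (∑ i, n i - a) (by omega) (by omega)
  have h4 : mm * (∑ i, n i - a) = mm * (∑ i, n i - (a+1)) + mm := by
    rw [← Nat.mul_succ]; congr 1; omega
  omega

theorem maxsrk_pi (A : ∀ i : Fin ℓ, Submodule F (Matrix (Fin mm) (Fin (n i)) F)) (R : Fin ℓ → ℕ)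
    (hA : ∀ i, Lev (A i) (R i)) : maxsrk (Submodule.pi Set.univ A) = ∑ i, R i := by
  apply IsGreatest.csSup_eq
  constructor
  · choose M hM hr using fun i => (hA i).exists_rank
    exact ⟨M, fun i _ => hM i, Finset.sum_congr rfl fun i _ => hr i⟩
  · rintro _ ⟨C, hC, rfl⟩
    exact Finset.sum_le_sum fun i _ => (hA i).rank_le _ (hC i (Set.mem_univ _))

theorem genWt_le_iff (hnm : ∀ i, n i ≤ mm)
    (C : Submodule F (∀ i : Fin ℓ, Matrix (Fin mm) (Fin (n i)) F)) (t a : ℕ)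
    (ht : t ≤ Module.finrank F C) (ha : a ≤ ∑ i, n i) :
    genWt C t ≤ a ↔ t ≤ fmax C a := by
  constructor
  · intro h
    have hne : {w | ∃ 𝒟 : Submodule F (∀ i : Fin ℓ, Matrix (Fin mm) (Fin (n i)) F),
      𝒟 ≤ C ∧ t ≤ Module.finrank F 𝒟 ∧ w = wtCode 𝒟}.Nonempty := ⟨_, C, le_rfl, ht, rfl⟩
    obtain ⟨D, hDC, hD, hw⟩ := Nat.sInf_mem hne
    have hne2 : {w | ∃ A : ∀ i : Fin ℓ, Submodule F (Matrix (Fin mm) (Fin (n i)) F),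
      (∀ i, IsOptRkAnticode (A i)) ∧ D ≤ Submodule.pi Set.univ A ∧
      w = maxsrk (Submodule.pi Set.univ A)}.Nonempty :=
      ⟨_, fun _ => ⊤, fun i => (lev_top (hnm i)).1, by simp, rfl⟩
    obtain ⟨A, hA, hDA, hw2⟩ := Nat.sInf_mem hne2
    have hLev : ∀ i, Lev (A i) _ := fun i => ⟨hA i, rfl⟩
    have hms := maxsrk_pi A _ hLev
    have hP : Prd (Submodule.pi Set.univ A) _ := ⟨A, _, hLev, rfl, hms.symm⟩
    have e1 : genWt C t = maxsrk (Submodule.pi Set.univ A) := hw.trans hw2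
    rw [← e1] at hP
    refine (hD.trans ?_).trans (fmax_mono hnm C _ a h ha)
    exact (Submodule.finrank_mono (le_inf hDC hDA)).trans (le_fmax C hP)
  · intro h
    obtain ⟨B, hB, hf⟩ := fmax_spec hnm C ha
    have h1 : genWt C t ≤ wtCode (C ⊓ B) := Nat.sInf_le ⟨C ⊓ B, inf_le_left, h.trans hf.le, rfl⟩
    refine h1.trans ?_
    obtain ⟨A, R, hA, rfl, rfl⟩ := hB
    exact Nat.sInf_le ⟨A, fun i => (hA i).1, inf_le_right, (maxsrk_pi A R hA).symm⟩

end

/-- **Wei duality** for sum-rank metric codes with `m₁ = ⋯ = m_ℓ = m`: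
for every `r ∈ [m]`, `D_r(𝒞^⊥) = [n] \ D̄_{r + dim 𝒞}(𝒞)`. -/
theorem wei_duality {F : Type*} [Field F] [Fintype F] {ℓ : ℕ} (mm : ℕ) (n : Fin ℓ → ℕ)
    (hℓ : 0 < ℓ) (hmpos : 0 < mm) (hnm : ∀ i, n i ≤ mm) (hnpos : ∀ i, 0 < n i)
    (𝒞 : Submodule F (∀ i : Fin ℓ, Matrix (Fin mm) (Fin (n i)) F))
    (r : ℕ) (hr : 1 ≤ r) (hrm : r ≤ mm) :
    Dset (dualCode 𝒞) r = Set.Icc 1 (∑ i, n i) \ DbarSet 𝒞 (r + Module.finrank F 𝒞) := by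

  have h := wei_arith (∑ i, n i) mm (Module.finrank F 𝒞) (Module.finrank F (dualCode 𝒞)) r hmpos
    (fmax 𝒞) (fmax (dualCode 𝒞)) (genWt 𝒞) (genWt (dualCode 𝒞))
    (fmax_zero hnm 𝒞) (fmax_top hnm 𝒞) (fmax_mono hnm 𝒞) (fmax_step hnm 𝒞)
    (fmax_zero hnm _) (fmax_top hnm _) (fmax_mono hnm _) (fmax_dual hnm 𝒞)
    (fun t a _ ht ha => genWt_le_iff hnm 𝒞 t a ht ha)
    (fun t a _ ht ha => genWt_le_iff hnm _ t a ht ha)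
  exact h
end

section
/- Let 𝒞 ⊆ 𝕄 be an MSRD code and write d(𝒞) = Σ_{i=1}^{j−1} n_i + δ + 1 for some j ∈ {1,…,ℓ} and 0 ≤ δ ≤ n_j − 1. Then for every r ∈ {1,…,dim(𝒞)} one has d_r(𝒞) = d_{Σ_{i=1}^{j−1} m_i n_i + m_j δ + r}(𝕄), where the generalized weights on the right-hand side are those of the full ambient space 𝕄. -/
open Matrix Finset

/-- Triangular system: a combination of matrices with nonzero determinant. -/
theorem exists_comb_det_ne_zero {F κ : Type*} [Field F] [Fintype κ] [DecidableEq κ] {M : ℕ}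
    (f : κ → Fin M) (hf : Function.Injective f) (N : κ → Matrix κ κ F)
    (hN : ∀ p l, f l < f p → ∀ k, N p l k = 0)
    (hdet : (Matrix.of fun l k => N l l k).det ≠ 0) :
    ∃ x : κ → F, (∑ p, x p • N p).det ≠ 0 := by
  have key : ∀ i : ℕ, ∃ x : κ → F,
      (Matrix.of fun l k => if (f l : ℕ) < i then (∑ p, x p • N p) l k else N l l k).det ≠ 0 := by
    intro i
    induction i with
    | zero => exact ⟨0, by simpa using hdet⟩
    | succ i ih =>
      obtain ⟨x, hx⟩ := ih
      by_cases hc : ∃ c, (f c : ℕ) = i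
      · obtain ⟨c, hc⟩ := hc
        set M0 := (Matrix.of fun l k => if (f l : ℕ) < i then (∑ p, x p • N p) l k else N l l k)
          with hM0
        let v : κ → F := fun k => (∑ p ∈ univ.erase c, x p • N p) c k
        have hrow : M0 c = N c c := by
          ext k; simp [hM0, hc]
        have main : ∀ t : F, (Matrix.of fun l k => if (f l : ℕ) < i + 1 then
            (∑ p, (Function.update x c t) p • N p) l k else N l l k)
              = M0.updateRow c (v + t • M0 c) := by
          intro t
          ext l k
          by_cases hl : l = c
          · subst hl
            rw [Matrix.updateRow_self, hrow]
            simp only [Matrix.of_apply, hc, Nat.lt_succ_self, if_true, v]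
            rw [← Finset.add_sum_erase _ _ (Finset.mem_univ l)]
            simp only [Function.update_self, Matrix.add_apply, Pi.add_apply, Matrix.smul_apply,
              Pi.smul_apply]
            rw [add_comm]
            have hs : ∑ p ∈ univ.erase l, Function.update x l t p • N p
                = ∑ p ∈ univ.erase l, x p • N p := by
              apply Finset.sum_congr rfl
              intro p hp
              rw [Function.update_of_ne (Finset.ne_of_mem_erase hp)]
            rw [hs]
          · rw [Matrix.updateRow_ne hl]
            have hne : (f l : ℕ) ≠ i := by
              intro h; apply hl; apply hf; apply Fin.ext; omega
            simp only [hM0, Matrix.of_apply]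
            by_cases hli : (f l : ℕ) < i
            · rw [if_pos hli, if_pos (by omega)]
              simp only [Matrix.sum_apply, Matrix.smul_apply]
              apply Finset.sum_congr rfl
              intro p _
              by_cases hp : p = c
              · subst hp
                rw [hN p l (by rw [Fin.lt_def]; omega) k]; simp
              · rw [Function.update_of_ne hp]
            · rw [if_neg hli, if_neg (by omega)]
        have hdt : ∀ t : F, (M0.updateRow c (v + t • M0 c)).det
            = (M0.updateRow c v).det + t * M0.det := by
          intro t
          rw [Matrix.det_updateRow_add, Matrix.det_updateRow_smul, Matrix.updateRow_eq_self]
        by_cases h0 : (M0.updateRow c v).det = 0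
        · refine ⟨Function.update x c 1, ?_⟩
          rw [main, hdt, h0]; simpa using hx
        · refine ⟨Function.update x c 0, ?_⟩
          rw [main, hdt]; simpa using h0
      · refine ⟨x, ?_⟩
        convert hx using 6 with l k
        have : (f l : ℕ) ≠ i := fun h => hc ⟨l, h⟩
        omega
  obtain ⟨x, hx⟩ := key M
  refine ⟨x, ?_⟩
  convert hx using 2
  ext l k
  simp

/-- leading positions of a subspace in row-major order -/
def IsLead {F : Type*} [Field F] {M N : ℕ} (A : Submodule F (Matrix (Fin M) (Fin N) F))
    (i : Fin M) (k : Fin N) : Prop :=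
  ∃ X ∈ A, X i k ≠ 0 ∧ (∀ i' < i, ∀ k', X i' k' = 0) ∧ (∀ k' < k, X i k' = 0)

theorem exists_lead {F : Type*} [Field F] {M N : ℕ} (A : Submodule F (Matrix (Fin M) (Fin N) F))
    (X : Matrix (Fin M) (Fin N) F) (hX : X ∈ A) (h0 : X ≠ 0) :
    ∃ i k, IsLead A i k ∧ X i k ≠ 0 := by
  classical
  have h1 : (univ.filter fun i => X i ≠ 0).Nonempty := by
    by_contra h
    apply h0
    rw [Finset.not_nonempty_iff_eq_empty, Finset.filter_eq_empty_iff] at h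
    ext i k
    have := h (Finset.mem_univ i)
    push Not at this
    rw [this]; rfl
  obtain ⟨i, hi, himin⟩ := Finset.exists_min_image _ id h1
  have h2 : (univ.filter fun k => X i k ≠ 0).Nonempty := by
    by_contra h
    rw [Finset.not_nonempty_iff_eq_empty, Finset.filter_eq_empty_iff] at h
    apply (Finset.mem_filter.1 hi).2
    ext k
    have := h (Finset.mem_univ k)
    push Not at this
    exact this
  obtain ⟨k, hk, hkmin⟩ := Finset.exists_min_image _ id h2
  refine ⟨i, k, ⟨X, hX, (Finset.mem_filter.1 hk).2, ?_, ?_⟩, (Finset.mem_filter.1 hk).2⟩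
  · intro i' hi' k'
    by_contra hne
    have : X i' ≠ 0 := fun h => hne (by rw [h]; rfl)
    exact absurd (himin i' (by simp [this])) (by simpa using hi')
  · intro k' hk'
    by_contra hne
    exact absurd (hkmin k' (by simp [hne])) (by simpa using hk')

theorem rank_of_matching {F : Type*} [Field F] {M N : ℕ}
    (A : Submodule F (Matrix (Fin M) (Fin N) F)) (Q : Finset (Fin N)) (f : Q → Fin M)
    (hf : Function.Injective f) (hlead : ∀ c : Q, IsLead A (f c) c) :
    ∃ X ∈ A, Q.card ≤ X.rank := by
  classical
  choose X hXA hX0 hX1 hX2 using hlead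
  obtain ⟨x, hx⟩ := exists_comb_det_ne_zero f hf (fun p => (X p).submatrix f (fun c : Q => (c : Fin N)))
    (by
      intro p l h k
      exact hX1 p _ h _)
    (by
      rw [Matrix.det_of_isUpperTriangular]
      · simp only [Matrix.of_apply, Matrix.submatrix_apply]
        exact Finset.prod_ne_zero_iff.2 fun c _ => hX0 c
      · intro a b hab
        exact hX2 a _ hab)
  refine ⟨∑ p, x p • X p, A.sum_mem fun p _ => A.smul_mem _ (hXA p), ?_⟩
  have h := Matrix.rank_of_det_ne_zero hx
  have h2 := Matrix.rank_submatrix_le (∑ p, x p • X p) f (fun c : Q => (c : Fin N))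
  have h3 : (∑ p, x p • X p).submatrix f (fun c : Q => (c : Fin N)) =
      ∑ p, x p • (X p).submatrix f (fun c : Q => (c : Fin N)) := by
    ext a b; simp [Matrix.sum_apply]
  rw [h3, h] at h2
  simpa using h2

/-- Structure of the leading set. -/
theorem lead_cover {F : Type*} [Field F] {M N a : ℕ} (hNM : N ≤ M)
    (A : Submodule F (Matrix (Fin M) (Fin N) F)) (ha : ∀ X ∈ A, X.rank ≤ a) (haN : a ≤ N)
    (hdim : M * a ≤ Module.finrank F A) :
    (∃ J : Finset (Fin N), J.card ≤ a ∧ ∀ i k, IsLead A i k → k ∈ J) ∨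
    (N = M ∧ ∃ T : Finset (Fin M), T.card ≤ a ∧ ∀ i k, IsLead A i k → i ∈ T) := by
  classical
  rcases haN.eq_or_lt with rfl | haN
  · left; exact ⟨univ, by simp, by simp⟩
  -- the leading set
  let P : Finset (Fin M × Fin N) := univ.filter fun p => IsLead A p.1 p.2
  have hP : Module.finrank F A ≤ P.card := by
    let φ : A →ₗ[F] (P → F) :=
      { toFun := fun X p => (X : Matrix (Fin M) (Fin N) F) p.1.1 p.1.2
        map_add' := by intros; rfl
        map_smul' := by intros; rfl }
    have hφ : Function.Injective φ := by
      rw [← LinearMap.ker_eq_bot, LinearMap.ker_eq_bot']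
      intro X hX
      by_contra hne
      obtain ⟨i, k, hl, h0⟩ := exists_lead A X X.2 (by simpa using hne)
      exact h0 (congrFun hX ⟨(i, k), by simp [P, hl]⟩)
    simpa using LinearMap.finrank_le_finrank_of_injective hφ
  -- Hall
  let t : Fin N → Finset (Fin M ⊕ Fin (N - a - 1)) := fun k =>
    univ.filter fun z => Sum.elim (fun i => IsLead A i k) (fun _ => True) z
  have hno : ¬ ∃ g : Fin N → (Fin M ⊕ Fin (N - a - 1)),
      Function.Injective g ∧ ∀ x, g x ∈ t x := by
    rintro ⟨g, hg, hgt⟩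
    let Q : Finset (Fin N) := univ.filter fun k => (g k).isLeft
    have hQc : (univ.filter fun k => ¬ (g k).isLeft).card ≤ N - a - 1 := by
      have : ((univ.filter fun k => ¬ (g k).isLeft).image g) ⊆
          (univ : Finset (Fin (N - a - 1))).map ⟨Sum.inr, Sum.inr_injective⟩ := by
        intro z hz
        simp only [Finset.mem_image, Finset.mem_filter, Finset.mem_univ, true_and] at hz
        obtain ⟨k, hk, rfl⟩ := hz
        cases h : g k with
        | inl z => simp [h] at hk
        | inr z => simp
      have h2 := Finset.card_le_card this
      rw [Finset.card_image_of_injective _ hg] at h2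
      simpa using h2
    have hsum := Finset.card_filter_add_card_filter_not (s := (univ : Finset (Fin N)))
      (fun k => (g k).isLeft = true)
    have hQ : a + 1 ≤ Q.card := by
      simp only [Finset.card_univ, Fintype.card_fin] at hsum
      have : Q.card = (univ.filter fun k => (g k).isLeft = true).card := rfl
      omega
    have hleft : ∀ c : Q, ∃ i, g c = Sum.inl i := by
      intro c
      exact Sum.isLeft_iff.1 (Finset.mem_filter.1 c.2).2
    choose f hf using hleft
    obtain ⟨X, hXA, hX⟩ := rank_of_matching A Q f
      (by
        intro c c' h
        apply Subtype.ext; apply hg; rw [hf, hf, h])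
      (by
        intro c
        have := hgt c
        rw [hf c] at this
        simpa [t] using this)
    have := ha X hXA
    omega
  rw [← Finset.all_card_le_biUnion_card_iff_exists_injective] at hno
  push Not at hno
  obtain ⟨S, hS⟩ := hno
  let T : Finset (Fin M) := univ.filter fun i => ∃ k ∈ S, IsLead A i k
  have hSne : S.Nonempty := by
    rw [Finset.nonempty_iff_ne_empty]; rintro rfl; simp at hS
  have hTS : T.card + (N - a - 1) < S.card := by
    refine lt_of_le_of_lt ?_ hS
    have : T.disjSum (univ : Finset (Fin (N - a - 1))) ⊆ S.biUnion t := by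
      intro z hz
      obtain ⟨k0, hk0⟩ := hSne
      rcases z with z | z
      · simpa [T, t] using hz
      · simp only [Finset.mem_biUnion]
        exact ⟨k0, hk0, by simp [t]⟩
    have := Finset.card_le_card this
    simpa using this
  have hSN : S.card ≤ N := by simpa using Finset.card_le_univ S
  have hPcard : P.card ≤ M * (N - S.card) + T.card * S.card := by
    have : P ⊆ ((univ : Finset (Fin M)) ×ˢ Sᶜ) ∪ (T ×ˢ S) := by
      rintro ⟨i, k⟩ hik
      have hik : IsLead A i k := by simpa [P] using hik
      by_cases hk : k ∈ S
      · simp only [Finset.mem_union, Finset.mem_product]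
        right
        exact ⟨by simp only [T, Finset.mem_filter, Finset.mem_univ, true_and]; exact ⟨k, hk, hik⟩, hk⟩
      · simp [hk]
    have := (Finset.card_le_card this).trans (Finset.card_union_le _ _)
    simpa [Finset.card_product, Finset.card_compl] using this
  by_cases hT : T.card = 0
  · left
    refine ⟨Sᶜ, by rw [Finset.card_compl, Fintype.card_fin]; omega, ?_⟩
    intro i k hik
    rw [Finset.mem_compl]
    intro hk
    have : i ∈ T := by
      simp only [T, Finset.mem_filter, Finset.mem_univ, true_and]; exact ⟨k, hk, hik⟩
    rw [Finset.card_eq_zero] at hT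
    simp [hT] at this
  · right
    have h1 : M * (N - S.card + T.card) ≤ M * a := Nat.mul_le_mul_left _ (by omega)
    have h2 : M * T.card ≤ S.card * T.card := by
      rw [mul_add] at h1; rw [mul_comm S.card]; omega
    have h3 : M ≤ S.card := Nat.le_of_mul_le_mul_right h2 (by omega)
    refine ⟨by omega, T, by omega, ?_⟩
    intro i k hik
    have hSu : S = univ := by
      rw [← Finset.card_eq_iff_eq_univ, Fintype.card_fin]; omega
    simp only [T, Finset.mem_filter, Finset.mem_univ, true_and]
    exact ⟨k, by simp [hSu], hik⟩


section colspan

set_option linter.unusedSectionVars false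
variable {F ι κ : Type*} [Field F] [Fintype ι] [Fintype κ] [DecidableEq κ]

theorem fact1 {a : ℕ} {A : Submodule F (Matrix ι κ F)} (ha : ∀ X ∈ A, X.rank ≤ a)
    (J : Finset κ) (X : Matrix ι κ F) (hX : X ∈ A)
    (hs : a ≤ Module.finrank F (Submodule.span F (X.col '' J))) (k : κ) :
    X.col k ∈ Submodule.span F (X.col '' J) := by
  have h1 : Submodule.span F (X.col '' J) ≤ Submodule.span F (Set.range X.col) :=
    Submodule.span_mono (Set.image_subset_range _ _)
  have h2 := ha X hX
  rw [Matrix.rank_eq_finrank_span_cols] at h2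
  rw [Submodule.eq_of_le_of_finrank_le h1 (h2.trans hs)]
  exact Submodule.subset_span ⟨k, rfl⟩

theorem exists_indep {V : Type*} [AddCommGroup V] [Module F V] [FiniteDimensional F V]
    (J : Finset κ) (j : κ) (hj : j ∈ J) (H : Submodule F V) (hH : J.card ≤ Module.finrank F H)
    (w : V) (hw : w ∈ H) (hw0 : w ≠ 0) :
    ∃ Y : κ → V, (LinearIndependent F fun c : J => Y c) ∧ (∀ c, Y c ∈ H) ∧ Y j = w := by
  classical
  have hli : LinearIndepOn F id ({⟨w, hw⟩} : Set H) := by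
    have hw0' : (⟨w, hw⟩ : H) ≠ 0 := by simpa using hw0
    exact (linearIndepOn_singleton_iff (R := F)).2 hw0'
  let b := Module.Basis.extend hli
  have hfin : Fintype (hli.extend (Set.subset_univ _)) := FiniteDimensional.fintypeBasisIndex b
  have hcard := Module.finrank_eq_card_basis b
  have hne : Nonempty (J ↪ hli.extend (Set.subset_univ _)) := by
    apply Function.Embedding.nonempty_of_card_le
    rw [Fintype.card_coe, ← hcard]; exact hH
  obtain ⟨σ⟩ := hne
  let w' : hli.extend (Set.subset_univ _) :=
    ⟨⟨w, hw⟩, hli.subset_extend _ (by simp)⟩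
  let τ : J → hli.extend (Set.subset_univ _) := fun c => Equiv.swap (σ ⟨j, hj⟩) w' (σ c)
  have hτ : Function.Injective τ := (Equiv.injective _).comp σ.injective
  refine ⟨fun c => if h : c ∈ J then ((b (τ ⟨c, h⟩) : H) : V) else 0, ?_, ?_, ?_⟩
  · have h1 := (b.linearIndependent.comp τ hτ).map' H.subtype (Submodule.ker_subtype H)
    have e : (fun c : J => if h : (c : κ) ∈ J then ((b (τ ⟨c, h⟩) : H) : V) else 0)
        = H.subtype ∘ b ∘ τ := by
      funext c; simp
    rw [e]; exact h1
  · intro c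
    by_cases h : c ∈ J
    · simp [h]
    · simp [h]
  · simp [hj, τ, b, w']

theorem col_span {a : ℕ} {A : Submodule F (Matrix ι κ F)} (ha : ∀ X ∈ A, X.rank ≤ a)
    (J : Finset κ) (hJ : J.card = a) (hdim : Fintype.card ι * a ≤ Module.finrank F A)
    (hinj : ∀ X ∈ A, (∀ k ∈ J, X.col k = 0) → X = 0) (hlt : a < Fintype.card ι)
    (X : Matrix ι κ F) (hX : X ∈ A) (k : κ) :
    X.col k ∈ Submodule.span F (X.col '' J) := by
  classical
  -- surjectivity
  have hsurj : ∀ Y : κ → ι → F, ∃ X ∈ A, ∀ j ∈ J, X.col j = Y j := by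
    let φ : A →ₗ[F] (J → ι → F) :=
      { toFun := fun X j i => (X : Matrix ι κ F) i j
        map_add' := by intros; rfl
        map_smul' := by intros; rfl }
    have hφ : Function.Injective φ := by
      rw [← LinearMap.ker_eq_bot, LinearMap.ker_eq_bot']
      intro X hX
      apply Subtype.ext
      apply hinj _ X.2
      intro j hj
      exact congrFun hX ⟨j, hj⟩
    have hfr : Module.finrank F (J → ι → F) = Fintype.card ι * a := by
      rw [Module.finrank_pi_fintype]; simp [hJ, mul_comm]
    have h2 : Module.finrank F A = Module.finrank F (J → ι → F) :=
      le_antisymm (LinearMap.finrank_le_finrank_of_injective hφ) (by rw [hfr]; exact hdim)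
    have hs := (LinearMap.injective_iff_surjective_of_finrank_eq_finrank h2).1 hφ
    intro Y
    obtain ⟨X, hX⟩ := hs (fun j => Y j)
    exact ⟨X, X.2, fun j hj => congrFun hX ⟨j, hj⟩⟩
  have fact2 : ∀ j ∈ J, ∀ X ∈ A, (∀ j' ∈ J, j' ≠ j → X.col j' = 0) →
      X.col k ∈ Submodule.span F {X.col j} := by
    intro j hj X hX hz
    by_cases hw : X.col j = 0
    · have : X = 0 := hinj X hX (fun k hk => by
        by_cases h : k = j
        · rw [h, hw]
        · exact hz k hk h)
      have h0 : X.col k = 0 := by rw [this]; rfl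
      rw [h0]; exact Submodule.zero_mem _
    by_cases hJ1 : ∃ j' ∈ J, j' ≠ j
    · obtain ⟨j', hj', hne⟩ := hJ1
      by_contra hu
      obtain ⟨g, hgu, hgw⟩ := Submodule.exists_le_ker_of_notMem hu
      have hwH : X.col j ∈ LinearMap.ker g := hgw (Submodule.mem_span_singleton_self _)
      have hH : J.card ≤ Module.finrank F (LinearMap.ker g) := by
        have h1 := LinearMap.finrank_range_add_finrank_ker g
        have h2 : Module.finrank F (LinearMap.range g) ≤ 1 := by
          simpa using Submodule.finrank_le (LinearMap.range g)
        simp only [Module.finrank_fintype_fun_eq_card] at h1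
        omega
      obtain ⟨Y, hYli, hYH, hYj⟩ := exists_indep J j' hj' _ hH _ hwH hw
      obtain ⟨Z, hZ, hZY⟩ := hsurj Y
      have hspanY : a ≤ Module.finrank F (Submodule.span F (Y '' J)) := by
        have := finrank_span_eq_card hYli
        rw [Fintype.card_coe, hJ] at this
        rw [← this, Set.image_eq_range]
        exact le_rfl
      have hZJ : Z.col '' J = Y '' J := Set.image_congr hZY
      have hYle : Submodule.span F (Y '' J) ≤ LinearMap.ker g := by
        rw [Submodule.span_le]
        rintro _ ⟨c, _, rfl⟩
        exact hYH c
      have h1 := fact1 ha J Z hZ (by rw [hZJ]; exact hspanY) k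
      rw [hZJ] at h1
      have hcol : ∀ c, (Z + X).col c = Z.col c + X.col c := fun c => rfl
      have hother : ∀ c ∈ J, c ≠ j → (Z + X).col c = Y c := by
        intro c hc hcj
        rw [hcol, hZY c hc, hz c hc hcj, add_zero]
      have hjj : (Z + X).col j = Y j + Y j' := by rw [hcol, hZY j hj, hYj]
      have h2 : (Z + X).col k ∈ Submodule.span F ((Z + X).col '' J) := by
        apply fact1 ha J _ (A.add_mem hZ hX)
        refine hspanY.trans (Submodule.finrank_mono ?_)
        rw [Submodule.span_le]
        rintro _ ⟨c, hc, rfl⟩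
        have hc : c ∈ J := hc
        by_cases hcj : c = j
        · subst hcj
          have e : Y c = (Z + X).col c - (Z + X).col j' := by
            rw [hjj, hother j' hj' hne]; simp
          rw [e]
          exact Submodule.sub_mem _ (Submodule.subset_span ⟨c, hc, rfl⟩)
            (Submodule.subset_span ⟨j', hj', rfl⟩)
        · exact Submodule.subset_span ⟨c, hc, hother c hc hcj⟩
      have h3 : Submodule.span F ((Z + X).col '' J) ≤ LinearMap.ker g := by
        rw [Submodule.span_le]
        rintro _ ⟨c, hc, rfl⟩
        by_cases hcj : c = j
        · subst hcj
          rw [hjj]; exact Submodule.add_mem _ (hYH _) (hYH _)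
        · rw [hother c hc hcj]; exact hYH _
      have h4 := Submodule.sub_mem _ (h3 h2) (hYle h1)
      rw [hcol, add_sub_cancel_left] at h4
      exact hgu h4
    · push Not at hJ1
      have hJs : J = {j} := by
        ext c; simp only [Finset.mem_singleton]
        exact ⟨hJ1 c, fun h => h ▸ hj⟩
      have ha1 : a = 1 := by rw [← hJ, hJs]; simp
      have e : X.col '' J = {X.col j} := by rw [hJs]; simp
      have := fact1 ha J X hX (by rw [e, finrank_span_singleton hw, ha1]) k
      rwa [e] at this
  have hdec : ∀ j : κ, ∃ Z ∈ A, ∀ c ∈ J, Z.col c = if c = j then X.col j else 0 :=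
    fun j => hsurj (fun c => if c = j then X.col j else 0)
  choose Z hZA hZ using hdec
  have hXsum : X = ∑ j ∈ J, Z j := by
    rw [← sub_eq_zero]
    apply hinj _ (A.sub_mem hX (A.sum_mem fun j _ => hZA j))
    intro c hc
    have : (X - ∑ j ∈ J, Z j).col c = X.col c - ∑ j ∈ J, (Z j).col c := by
      ext i; simp [Matrix.sum_apply]
    rw [this, Finset.sum_congr rfl fun j _ => hZ j c hc]
    simp [hc]
  have hk : X.col k = ∑ j ∈ J, (Z j).col k := by
    ext i
    conv_lhs => rw [hXsum]
    simp [Matrix.sum_apply]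
  rw [hk]
  apply Submodule.sum_mem
  intro j hj
  have h := fact2 j hj (Z j) (hZA j) (by
    intro j' hj' hne
    rw [hZ j j' hj', if_neg hne])
  rw [hZ j j hj, if_pos rfl] at h
  exact Submodule.span_mono (by
    rintro _ rfl
    exact ⟨j, hj, rfl⟩) h

theorem sub_of_col {a : ℕ} {A : Submodule F (Matrix ι κ F)} (ha : ∀ X ∈ A, X.rank ≤ a)
    (J : Finset κ) (hJ : J.card = a) (hdim : Fintype.card ι * a ≤ Module.finrank F A)
    (hinj : ∀ X ∈ A, (∀ k ∈ J, X.col k = 0) → X = 0) (hle : Fintype.card κ ≤ Fintype.card ι)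
    (b : ℕ) (hb : b ≤ a) :
    ∃ B ≤ A, Fintype.card ι * b ≤ Module.finrank F B ∧ ∀ X ∈ B, X.rank ≤ b := by
  classical
  have hcs : ∀ X ∈ A, ∀ k, X.col k ∈ Submodule.span F (X.col '' J) := by
    intro X hX k
    by_cases hk : k ∈ J
    · exact Submodule.subset_span ⟨k, hk, rfl⟩
    · refine col_span ha J hJ hdim hinj ?_ X hX k
      have : J.card < Fintype.card κ := Finset.card_lt_univ_of_notMem hk
      omega
  obtain ⟨Jb, hJb, hJbc⟩ := Finset.exists_subset_card_eq (hJ ▸ hb : b ≤ J.card)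
  let φ : A →ₗ[F] ((J \ Jb : Finset κ) → ι → F) :=
      { toFun := fun X j i => (X : Matrix ι κ F) i j
        map_add' := by intros; rfl
        map_smul' := by intros; rfl }
  refine ⟨(LinearMap.ker φ).map A.subtype, Submodule.map_subtype_le _ _, ?_, ?_⟩
  · rw [Submodule.finrank_map_subtype_eq]
    have h1 := LinearMap.finrank_range_add_finrank_ker φ
    have h2 := Submodule.finrank_le (LinearMap.range φ)
    have h3 : Module.finrank F ((J \ Jb : Finset κ) → ι → F) = Fintype.card ι * (a - b) := by
      rw [Module.finrank_pi_fintype]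
      simp only [Module.finrank_fintype_fun_eq_card, Finset.sum_const, Finset.card_univ,
        Fintype.card_coe, smul_eq_mul]
      rw [Finset.card_sdiff_of_subset hJb, hJ, hJbc, mul_comm]
    have h4 : Fintype.card ι * (a - b) + Fintype.card ι * b = Fintype.card ι * a := by
      rw [← mul_add]; congr 1; omega
    omega
  · rintro _ ⟨X, hX, rfl⟩
    have hX : φ X = 0 := hX
    have hz : ∀ j ∈ J \ Jb, (X : Matrix ι κ F).col j = 0 := fun j hj => congrFun hX ⟨j, hj⟩
    rw [Matrix.rank_eq_finrank_span_cols]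
    have hsp : Submodule.span F (Set.range (X : Matrix ι κ F).col) ≤
        Submodule.span F ((Jb.image (X : Matrix ι κ F).col : Finset (ι → F)) : Set (ι → F)) := by
      rw [Submodule.span_le]
      rintro _ ⟨k, rfl⟩
      refine (Submodule.span_le.2 ?_) (hcs X X.2 k)
      rintro _ ⟨j, hj, rfl⟩
      by_cases hjb : j ∈ Jb
      · exact Submodule.subset_span (by simp only [Finset.coe_image]; exact ⟨j, hjb, rfl⟩)
      · rw [hz j (Finset.mem_sdiff.2 ⟨hj, hjb⟩)]; exact Submodule.zero_mem _
    refine (Submodule.finrank_mono hsp).trans ((finrank_span_finset_le_card _).trans ?_)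
    exact Finset.card_image_le.trans hJbc.le
end colspan

theorem lead_inj {F : Type*} [Field F] {M N a : ℕ} (hNM : N ≤ M)
    (A : Submodule F (Matrix (Fin M) (Fin N) F)) (ha : ∀ X ∈ A, X.rank ≤ a) (haN : a ≤ N)
    (hdim : M * a ≤ Module.finrank F A) :
    (∃ J : Finset (Fin N), J.card = a ∧ ∀ X ∈ A, (∀ k ∈ J, X.col k = 0) → X = 0) ∨
    (N = M ∧ ∃ T : Finset (Fin M), T.card = a ∧ ∀ X ∈ A, (∀ i ∈ T, X.row i = 0) → X = 0) := by
  rcases lead_cover hNM A ha haN hdim with ⟨J, hJ, h⟩ | ⟨hN, T, hT, h⟩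
  · left
    obtain ⟨J', hJJ, hJ'⟩ := Finset.exists_superset_card_eq hJ (by simpa using haN)
    refine ⟨J', hJ', fun X hX hz => ?_⟩
    by_contra h0
    obtain ⟨i, k, hl, hne⟩ := exists_lead A X hX h0
    exact hne (congrFun (hz k (hJJ (h i k hl))) i)
  · right
    obtain ⟨J', hJJ, hJ'⟩ := Finset.exists_superset_card_eq hT (by simpa using haN.trans hNM)
    refine ⟨hN, J', hJ', fun X hX hz => ?_⟩
    by_contra h0
    obtain ⟨i, k, hl, hne⟩ := exists_lead A X hX h0
    exact hne (congrFun (hz i (hJJ (h i k hl))) k)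

theorem anticode_bound {F : Type*} [Field F] {M N a : ℕ} (hNM : N ≤ M)
    (A : Submodule F (Matrix (Fin M) (Fin N) F)) (ha : ∀ X ∈ A, X.rank ≤ a) (haN : a ≤ N) :
    Module.finrank F A ≤ M * a := by
  by_contra hcon
  push Not at hcon
  rcases lead_inj hNM A ha haN hcon.le with ⟨J, hJ, h⟩ | ⟨hN, T, hT, h⟩
  · let φ : A →ₗ[F] (J → Fin M → F) :=
      { toFun := fun X j i => (X : Matrix (Fin M) (Fin N) F) i j
        map_add' := by intros; rfl
        map_smul' := by intros; rfl }
    have hφ : Function.Injective φ := by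
      rw [← LinearMap.ker_eq_bot, LinearMap.ker_eq_bot']
      intro X hX
      exact Subtype.ext (h _ X.2 fun j hj => congrFun hX ⟨j, hj⟩)
    have h1 := LinearMap.finrank_le_finrank_of_injective hφ
    rw [Module.finrank_pi_fintype] at h1
    simp only [Module.finrank_fintype_fun_eq_card, Finset.sum_const, Finset.card_univ,
        Fintype.card_coe, smul_eq_mul, Fintype.card_fin, hJ] at h1
    rw [mul_comm] at h1
    omega
  · subst hN
    let φ : A →ₗ[F] (T → Fin N → F) :=
      { toFun := fun X j i => (X : Matrix (Fin N) (Fin N) F) j i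
        map_add' := by intros; rfl
        map_smul' := by intros; rfl }
    have hφ : Function.Injective φ := by
      rw [← LinearMap.ker_eq_bot, LinearMap.ker_eq_bot']
      intro X hX
      exact Subtype.ext (h _ X.2 fun j hj => congrFun hX ⟨j, hj⟩)
    have h1 := LinearMap.finrank_le_finrank_of_injective hφ
    rw [Module.finrank_pi_fintype] at h1
    simp only [Module.finrank_fintype_fun_eq_card, Finset.sum_const, Finset.card_univ,
        Fintype.card_coe, smul_eq_mul, Fintype.card_fin, hT] at h1
    rw [mul_comm] at h1
    omega

theorem sub_anticode {F : Type*} [Field F] {M N a : ℕ} (hNM : N ≤ M)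
    (A : Submodule F (Matrix (Fin M) (Fin N) F)) (ha : ∀ X ∈ A, X.rank ≤ a) (haN : a ≤ N)
    (hdim : M * a ≤ Module.finrank F A) (b : ℕ) (hb : b ≤ a) :
    ∃ B ≤ A, M * b ≤ Module.finrank F B ∧ ∀ X ∈ B, X.rank ≤ b := by
  rcases lead_inj hNM A ha haN hdim with ⟨J, hJ, h⟩ | ⟨hN, T, hT, h⟩
  · simpa using sub_of_col ha J hJ (by simpa using hdim) h (by simpa using hNM) b hb
  · subst hN
    have hBmap : ∀ D : Submodule F (Matrix (Fin N) (Fin N) F),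
        ∃ D' : Submodule F (Matrix (Fin N) (Fin N) F),
          Module.finrank F D' = Module.finrank F D ∧ ∀ X, X ∈ D' ↔ Xᵀ ∈ D := by
      intro D
      let e := Matrix.transposeLinearEquiv (Fin N) (Fin N) F F
      refine ⟨D.map e.toLinearMap, LinearEquiv.finrank_map_eq e D, fun X => ?_⟩
      constructor
      · rintro ⟨Y, hY, h⟩
        have h' : Yᵀ = X := h
        rw [← h', Matrix.transpose_transpose]
        exact hY
      · intro hX
        exact ⟨Xᵀ, hX, Matrix.transpose_transpose X⟩
    obtain ⟨A', hA'd, hA'⟩ := hBmap A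
    obtain ⟨B, hBA, hBd, hBr⟩ := sub_of_col (A := A') (a := a)
      (by
        intro X hX
        rw [← Matrix.rank_transpose X]
        exact ha _ ((hA' X).1 hX)) T hT
      (by rw [hA'd]; simpa using hdim)
      (by
        intro X hX hz
        have h0 := h Xᵀ ((hA' X).1 hX) hz
        rw [← Matrix.transpose_transpose X, h0, Matrix.transpose_zero]) le_rfl b hb
    obtain ⟨B', hB'd, hB'⟩ := hBmap B
    refine ⟨B', ?_, ?_, ?_⟩
    · intro X hX
      have h1 := (hA' _).1 (hBA ((hB' X).1 hX))
      rwa [Matrix.transpose_transpose] at h1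
    · rw [hB'd]; simpa using hBd
    · intro X hX
      rw [← Matrix.rank_transpose X]
      exact hBr _ ((hB' X).1 hX)

section numeric

/-- greedy filling -/
def greedy (x : ℕ → ℕ) (s : ℕ) (i : ℕ) : ℕ :=
  min (∑ k ∈ range (i + 1), x k) s - min (∑ k ∈ range i, x k) s

theorem greedy_sum (x : ℕ → ℕ) (s k : ℕ) :
    ∑ i ∈ range k, greedy x s i = min (∑ i ∈ range k, x i) s := by
  induction k with
  | zero => simp
  | succ k ih =>
    rw [Finset.sum_range_succ, ih, greedy, Finset.sum_range_succ]; omega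

theorem greedy_le (x : ℕ → ℕ) (s i : ℕ) : greedy x s i ≤ x i := by
  rw [greedy, Finset.sum_range_succ]; omega

theorem dominance (L : ℕ) (m x y : ℕ → ℕ) (hm : Antitone m)
    (h : ∀ k ≤ L, ∑ i ∈ range k, x i ≤ ∑ i ∈ range k, y i) :
    ∑ i ∈ range L, m i * x i ≤ ∑ i ∈ range L, m i * y i := by
  have key : ∀ k ≤ L, (m k : ℤ) * ((∑ i ∈ range k, y i : ℕ) - (∑ i ∈ range k, x i : ℕ) : ℤ) ≤
      (∑ i ∈ range k, m i * y i : ℕ) - (∑ i ∈ range k, m i * x i : ℕ) := by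
    intro k
    induction k with
    | zero => simp
    | succ k ih =>
      intro hk
      have h1 := ih (by omega)
      have h2 := h (k + 1) hk
      have h3 := hm (Nat.le_succ k)
      simp only [Finset.sum_range_succ] at h2 ⊢
      push_cast at h1 ⊢
      zify at h2 h3
      nlinarith
  have h1 := key L le_rfl
  have h2 : (0 : ℤ) ≤ (m L : ℤ) * ((∑ i ∈ range L, y i : ℕ) - (∑ i ∈ range L, x i : ℕ) : ℤ) :=
    mul_nonneg (by positivity) (by have := h L le_rfl; omega)
  omega

theorem numeric_range (L : ℕ) (m a n e : ℕ → ℕ) (hm : Antitone m) (han : ∀ i, a i ≤ n i)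
    (hen : ∀ i, e i ≤ n i) (hs : ∑ i ∈ range L, e i ≤ ∑ i ∈ range L, a i) :
    ∃ b a' : ℕ → ℕ, (∀ i, b i ≤ a i) ∧ ∑ i ∈ range L, b i = ∑ i ∈ range L, e i ∧
      (∀ i, a' i ≤ n i) ∧ ∑ i ∈ range L, a' i = ∑ i ∈ range L, a i ∧
      ∑ i ∈ range L, m i * e i + ∑ i ∈ range L, m i * a i ≤
        ∑ i ∈ range L, m i * a' i + ∑ i ∈ range L, m i * b i := by
  refine ⟨greedy a (∑ i ∈ range L, e i), greedy n (∑ i ∈ range L, a i), greedy_le _ _, ?_,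
    greedy_le _ _, ?_, ?_⟩
  · rw [greedy_sum]; omega
  · rw [greedy_sum]
    have : ∑ i ∈ range L, a i ≤ ∑ i ∈ range L, n i := Finset.sum_le_sum fun i _ => han i
    omega
  · rw [← Finset.sum_add_distrib, ← Finset.sum_add_distrib]
    simp only [← mul_add]
    apply dominance _ _ _ _ hm
    intro k hk
    rw [Finset.sum_add_distrib, Finset.sum_add_distrib, greedy_sum, greedy_sum]
    have h1 : ∑ i ∈ range k, a i ≤ ∑ i ∈ range k, n i := Finset.sum_le_sum fun i _ => han i
    have h2 : ∑ i ∈ range k, e i ≤ ∑ i ∈ range k, n i := Finset.sum_le_sum fun i _ => hen i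
    have h3 : ∑ i ∈ range k, e i ≤ ∑ i ∈ range L, e i :=
      Finset.sum_le_sum_of_subset (Finset.range_mono hk)
    have h4 : ∑ i ∈ range k, a i ≤ ∑ i ∈ range L, a i :=
      Finset.sum_le_sum_of_subset (Finset.range_mono hk)
    omega

theorem numeric_fin {ℓ : ℕ} (m a n e : Fin ℓ → ℕ) (hm : ∀ i j : Fin ℓ, i ≤ j → m j ≤ m i)
    (han : ∀ i, a i ≤ n i)
    (hen : ∀ i, e i ≤ n i) (hs : ∑ i, e i ≤ ∑ i, a i) :
    ∃ b a' : Fin ℓ → ℕ, (∀ i, b i ≤ a i) ∧ ∑ i, b i = ∑ i, e i ∧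
      (∀ i, a' i ≤ n i) ∧ ∑ i, a' i = ∑ i, a i ∧
      ∑ i, m i * e i + ∑ i, m i * a i ≤ ∑ i, m i * a' i + ∑ i, m i * b i := by
  let E : (Fin ℓ → ℕ) → ℕ → ℕ := fun g i => if h : i < ℓ then g ⟨i, h⟩ else 0
  have hE : ∀ g (i : Fin ℓ), E g i = g i := fun g i => by simp [E]
  have hEle : ∀ g g' : Fin ℓ → ℕ, (∀ i, g i ≤ g' i) → ∀ i, E g i ≤ E g' i := by
    intro g g' h i
    simp only [E]; split_ifs
    · exact h _
    · exact le_rfl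
  have hmE : Antitone (E m) := by
    intro i k hik
    simp only [E]
    split_ifs with h1 h2
    · exact hm _ _ hik
    · omega
    · omega
    · omega
  obtain ⟨b, a', h1, h2, h3, h4, h5⟩ := numeric_range ℓ (E m) (E a) (E n) (E e) hmE
    (hEle _ _ han) (hEle _ _ hen) (by simpa only [Finset.sum_range, hE] using hs)
  refine ⟨fun i => b i, fun i => a' i, fun i => by simpa only [hE] using h1 i, ?_,
    fun i => by simpa only [hE] using h3 i, ?_, ?_⟩
  · simpa only [Finset.sum_range, hE] using h2
  · simpa only [Finset.sum_range, hE] using h4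
  · simpa only [Finset.sum_range, hE] using h5

end numeric

section assembly

set_option linter.unusedSectionVars false
variable {F : Type*} [Field F] [Fintype F]

/-- maximal rank of a matrix space -/
noncomputable def mrk {M N : ℕ} (A : Submodule F (Matrix (Fin M) (Fin N) F)) : ℕ :=
  sSup {r | ∃ X ∈ A, (X : Matrix (Fin M) (Fin N) F).rank = r}

theorem mrk_bdd {M N : ℕ} (A : Submodule F (Matrix (Fin M) (Fin N) F)) :
    BddAbove {r | ∃ X ∈ A, (X : Matrix (Fin M) (Fin N) F).rank = r} := by
  refine ⟨N, ?_⟩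
  rintro _ ⟨X, _, rfl⟩
  exact X.rank_le_width

theorem rank_le_mrk {M N : ℕ} (A : Submodule F (Matrix (Fin M) (Fin N) F)) :
    ∀ X ∈ A, X.rank ≤ mrk A := fun X hX => le_csSup (mrk_bdd A) ⟨X, hX, rfl⟩

theorem exists_mrk {M N : ℕ} (A : Submodule F (Matrix (Fin M) (Fin N) F)) :
    ∃ X ∈ A, X.rank = mrk A := by
  have hne : {r | ∃ X ∈ A, (X : Matrix (Fin M) (Fin N) F).rank = r}.Nonempty :=
    ⟨_, 0, A.zero_mem, rfl⟩
  exact Nat.sSup_mem hne (mrk_bdd A)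

theorem mrk_le {M N : ℕ} (A : Submodule F (Matrix (Fin M) (Fin N) F)) (t : ℕ)
    (h : ∀ X ∈ A, X.rank ≤ t) : mrk A ≤ t := by
  obtain ⟨X, hX, e⟩ := exists_mrk A
  exact e ▸ h X hX

theorem exists_std {M N t : ℕ} (hNM : N ≤ M) (ht : t ≤ N) :
    ∃ A : Submodule F (Matrix (Fin M) (Fin N) F), IsOptRkAnticode A ∧
      Module.finrank F A = M * t ∧ ∀ X ∈ A, X.rank ≤ t := by
  obtain ⟨B, -, hd, hr⟩ := sub_anticode hNM (⊤ : Submodule F (Matrix (Fin M) (Fin N) F)) (a := N)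
    (fun X _ => X.rank_le_width) le_rfl (by simp [Module.finrank_matrix]) t ht
  have h1 := anticode_bound hNM B (rank_le_mrk B) ((mrk_le B t hr).trans ht)
  have h2 : M * mrk B ≤ M * t := Nat.mul_le_mul_left _ (mrk_le B t hr)
  refine ⟨B, ?_, by omega, hr⟩
  change Module.finrank F B = M * mrk B
  omega

variable {ℓ : ℕ} {m n : Fin ℓ → ℕ}

theorem finrank_pi_sub_s10 (A : ∀ i : Fin ℓ, Submodule F (Matrix (Fin (m i)) (Fin (n i)) F)) :
    Module.finrank F (Submodule.pi Set.univ A) = ∑ i, Module.finrank F (A i) := by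
  let e : (Submodule.pi Set.univ A) ≃ₗ[F] (∀ i, A i) :=
    { toFun := fun X i => ⟨X.1 i, X.2 i (Set.mem_univ i)⟩
      invFun := fun Y => ⟨fun i => (Y i).1, fun i _ => (Y i).2⟩
      map_add' := by intros; rfl
      map_smul' := by intros; rfl
      left_inv := by intro X; rfl
      right_inv := by intro X; rfl }
  rw [e.finrank_eq, Module.finrank_pi_fintype]

theorem maxsrk_ge (A : ∀ i : Fin ℓ, Submodule F (Matrix (Fin (m i)) (Fin (n i)) F)) :
    ∑ i, mrk (A i) ≤ maxsrk (Submodule.pi Set.univ A) := by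
  choose X hX hr using fun i => exists_mrk (A i)
  refine le_csSup ⟨∑ i, n i, ?_⟩ ⟨X, fun i _ => hX i, Finset.sum_congr rfl fun i _ => hr i⟩
  rintro _ ⟨C, _, rfl⟩
  exact Finset.sum_le_sum fun i _ => (C i).rank_le_width

theorem maxsrk_le (A : ∀ i : Fin ℓ, Submodule F (Matrix (Fin (m i)) (Fin (n i)) F))
    (a : Fin ℓ → ℕ) (h : ∀ i, ∀ X ∈ A i, X.rank ≤ a i) :
    maxsrk (Submodule.pi Set.univ A) ≤ ∑ i, a i := by
  apply csSup_le'
  rintro _ ⟨C, hC, rfl⟩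
  exact Finset.sum_le_sum fun i _ => h i _ (hC i (Set.mem_univ i))

theorem wtCode_le (𝒟 : Submodule F (∀ i : Fin ℓ, Matrix (Fin (m i)) (Fin (n i)) F))
    (A : ∀ i : Fin ℓ, Submodule F (Matrix (Fin (m i)) (Fin (n i)) F))
    (hA : ∀ i, IsOptRkAnticode (A i)) (h : 𝒟 ≤ Submodule.pi Set.univ A) :
    wtCode 𝒟 ≤ maxsrk (Submodule.pi Set.univ A) := Nat.sInf_le ⟨A, hA, h, rfl⟩

theorem exists_wtCode (hnm : ∀ i, n i ≤ m i)
    (𝒟 : Submodule F (∀ i : Fin ℓ, Matrix (Fin (m i)) (Fin (n i)) F)) :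
    ∃ A : ∀ i : Fin ℓ, Submodule F (Matrix (Fin (m i)) (Fin (n i)) F),
      (∀ i, IsOptRkAnticode (A i)) ∧ 𝒟 ≤ Submodule.pi Set.univ A ∧
      wtCode 𝒟 = maxsrk (Submodule.pi Set.univ A) := by
  apply Nat.sInf_mem (s := {w | ∃ A : ∀ i : Fin ℓ, Submodule F (Matrix (Fin (m i)) (Fin (n i)) F),
    (∀ i, IsOptRkAnticode (A i)) ∧ 𝒟 ≤ Submodule.pi Set.univ A ∧
    w = maxsrk (Submodule.pi Set.univ A)})
  choose A hA hd _ using fun i => exists_std (F := F) (hnm i) (le_refl (n i))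
  refine ⟨_, A, hA, ?_, rfl⟩
  have : ∀ i, A i = ⊤ := by
    intro i
    apply Submodule.eq_top_of_finrank_eq
    rw [hd i]; simp [Module.finrank_matrix]
  intro X _ i _
  change X i ∈ A i
  rw [this i]; trivial

theorem genWt_le (𝒞 𝒟 : Submodule F (∀ i : Fin ℓ, Matrix (Fin (m i)) (Fin (n i)) F)) (r : ℕ)
    (h : 𝒟 ≤ 𝒞) (hr : r ≤ Module.finrank F 𝒟) : genWt 𝒞 r ≤ wtCode 𝒟 :=
  Nat.sInf_le ⟨𝒟, h, hr, rfl⟩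

theorem exists_genWt (𝒞 : Submodule F (∀ i : Fin ℓ, Matrix (Fin (m i)) (Fin (n i)) F)) (r : ℕ)
    (hr : r ≤ Module.finrank F 𝒞) : ∃ 𝒟 ≤ 𝒞, r ≤ Module.finrank F 𝒟 ∧ genWt 𝒞 r = wtCode 𝒟 :=
  Nat.sInf_mem (s := {w | ∃ 𝒟 : Submodule F (∀ i : Fin ℓ, Matrix (Fin (m i)) (Fin (n i)) F),
    𝒟 ≤ 𝒞 ∧ r ≤ Module.finrank F 𝒟 ∧ w = wtCode 𝒟}) ⟨_, 𝒞, le_rfl, hr, rfl⟩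

theorem dmin_le (𝒞 : Submodule F (∀ i : Fin ℓ, Matrix (Fin (m i)) (Fin (n i)) F)) (C)
    (hC : C ∈ 𝒞) (h0 : C ≠ 0) : dmin 𝒞 ≤ srk C := Nat.sInf_le ⟨C, hC, h0, rfl⟩

/-- Core statement with an abstract filling vector `e`. -/
theorem genWt_core (hm : ∀ i j : Fin ℓ, i ≤ j → m j ≤ m i) (hnm : ∀ i, n i ≤ m i)
    (𝒞 : Submodule F (∀ i : Fin ℓ, Matrix (Fin (m i)) (Fin (n i)) F))
    (e : Fin ℓ → ℕ) (hen : ∀ i, e i ≤ n i) (hd : dmin 𝒞 = ∑ i, e i + 1)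
    (hdim : Module.finrank F 𝒞 + ∑ i, m i * e i = ∑ i, m i * n i)
    (r : ℕ) (hr : 1 ≤ r) (hrdim : r ≤ Module.finrank F 𝒞) :
    genWt 𝒞 r = genWt (⊤ : Submodule F (∀ i : Fin ℓ, Matrix (Fin (m i)) (Fin (n i)) F))
      (∑ i, m i * e i + r) := by
  have htop : Module.finrank F (∀ i : Fin ℓ, Matrix (Fin (m i)) (Fin (n i)) F)
      = ∑ i, m i * n i := by
    rw [Module.finrank_pi_fintype]
    simp [Module.finrank_matrix]
  apply le_antisymm
  · obtain ⟨𝒟, -, h𝒟, hw⟩ := exists_genWt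
      (⊤ : Submodule F (∀ i : Fin ℓ, Matrix (Fin (m i)) (Fin (n i)) F)) (∑ i, m i * e i + r)
      (by rw [finrank_top, htop]; omega)
    obtain ⟨A, hA, hDA, hwA⟩ := exists_wtCode hnm 𝒟
    rw [hw, hwA]
    refine (genWt_le 𝒞 (𝒞 ⊓ Submodule.pi Set.univ A) r inf_le_left ?_).trans
      (wtCode_le _ A hA inf_le_right)
    have h1 := Submodule.finrank_sup_add_finrank_inf_eq 𝒞 (Submodule.pi Set.univ A)
    have h2 := Submodule.finrank_le (𝒞 ⊔ Submodule.pi Set.univ A)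
    have h3 := Submodule.finrank_mono hDA
    rw [htop] at h2
    omega
  · obtain ⟨𝒟, h𝒟C, h𝒟, hw⟩ := exists_genWt 𝒞 r hrdim
    obtain ⟨A, hA, hDA, hwA⟩ := exists_wtCode hnm 𝒟
    rw [hw, hwA]
    refine le_trans ?_ (maxsrk_ge A)
    have hA' : ∀ i, Module.finrank F (A i) = m i * mrk (A i) := hA
    have han : ∀ i, mrk (A i) ≤ n i := fun i => mrk_le _ _ fun X _ => X.rank_le_width
    have hs : ∑ i, e i ≤ ∑ i, mrk (A i) := by
      have hne : 𝒟 ≠ ⊥ := by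
        rintro rfl; simp at h𝒟; omega
      obtain ⟨C, hC, hC0⟩ := Submodule.exists_mem_ne_zero_of_ne_bot hne
      have h1 := dmin_le 𝒞 C (h𝒟C hC) hC0
      have h2 : srk C ≤ ∑ i, mrk (A i) :=
        Finset.sum_le_sum fun i _ => rank_le_mrk _ _ (hDA hC i (Set.mem_univ i))
      omega
    obtain ⟨b, a', hb, hbs, ha', ha's, hfin⟩ := numeric_fin m (fun i => mrk (A i)) n e hm han hen hs
    choose B hBA hBd hBr using fun i => sub_anticode (hnm i) (A i) (rank_le_mrk _) (han i)
      (hA' i).ge (b i) (hb i)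
    choose S hS hSd hSr using fun i => exists_std (F := F) (hnm i) (ha' i)
    have hdisj : 𝒟 ⊓ Submodule.pi Set.univ B = ⊥ := by
      rw [Submodule.eq_bot_iff]
      intro C hC
      by_contra hC0
      have h1 := dmin_le 𝒞 C (h𝒟C hC.1) hC0
      have h2 : srk C ≤ ∑ i, b i :=
        Finset.sum_le_sum fun i _ => hBr i _ (hC.2 i (Set.mem_univ i))
      omega
    have h1 := Submodule.finrank_sup_add_finrank_inf_eq 𝒟 (Submodule.pi Set.univ B)
    rw [hdisj, finrank_bot] at h1
    have h2 := Submodule.finrank_mono (sup_le hDA (Submodule.pi_mono (s := Set.univ)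
      fun i _ => hBA i))
    rw [finrank_pi_sub_s10 A, Finset.sum_congr rfl fun i _ => hA' i] at h2
    have h3 : ∑ i, m i * b i ≤ Module.finrank F (Submodule.pi Set.univ B) := by
      rw [finrank_pi_sub_s10]; exact Finset.sum_le_sum fun i _ => hBd i
    have h4 : Module.finrank F (Submodule.pi Set.univ S) = ∑ i, m i * a' i := by
      rw [finrank_pi_sub_s10]; exact Finset.sum_congr rfl fun i _ => hSd i
    refine (genWt_le _ (Submodule.pi Set.univ S) _ le_top (by rw [h4]; omega)).trans ?_
    refine (wtCode_le _ S hS le_rfl).trans ?_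
    rw [← ha's]
    exact maxsrk_le S a' hSr

end assembly

/-- Generalized weights of an MSRD code: if `𝒞` is MSRD with
`d(𝒞) = n₁ + ⋯ + n_{j-1} + δ + 1`, then for all `r ∈ [dim 𝒞]`,
`d_r(𝒞) = d_{m₁n₁ + ⋯ + m_{j-1}n_{j-1} + m_j δ + r}(𝕄)`. -/
theorem genWt_of_MSRD {F : Type*} [Field F] [Fintype F] {ℓ : ℕ}
    (m n : Fin ℓ → ℕ) (hℓ : 0 < ℓ) (hm : ∀ i j : Fin ℓ, i ≤ j → m j ≤ m i)
    (hmpos : ∀ i, 0 < m i) (hnm : ∀ i, n i ≤ m i) (hnpos : ∀ i, 0 < n i)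
    (𝒞 : Submodule F (∀ i : Fin ℓ, Matrix (Fin (m i)) (Fin (n i)) F))
    (hMSRD : IsMSRD 𝒞) (j : Fin ℓ) (δ : ℕ) (hδ : δ ≤ n j - 1)
    (hd : dmin 𝒞 = ∑ i ∈ Finset.Iio j, n i + δ + 1)
    (r : ℕ) (hr : 1 ≤ r) (hrdim : r ≤ Module.finrank F 𝒞) :
    genWt 𝒞 r =
      genWt (⊤ : Submodule F (∀ i : Fin ℓ, Matrix (Fin (m i)) (Fin (n i)) F))
        (∑ i ∈ Finset.Iio j, m i * n i + m j * δ + r) := by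
  have hsplit : ∀ g : Fin ℓ → ℕ, ∑ i, g i
      = ∑ i ∈ Finset.Iio j, g i + ∑ i ∈ Finset.Ici j, g i := by
    intro g
    rw [← Finset.sum_union]
    · congr 1; ext i; simp [lt_or_ge]
    · rw [Finset.disjoint_left]; intro i; simp
  -- uniqueness of `j` and `δ`
  obtain ⟨j', δ', hδ', hd', hdim'⟩ := hMSRD
  have hmono : ∀ p q : Fin ℓ, p < q →
      ∑ i ∈ Finset.Iio p, n i + n p ≤ ∑ i ∈ Finset.Iio q, n i := by
    intro p q hpq
    have : insert p (Finset.Iio p) ⊆ Finset.Iio q := by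
      intro i hi
      simp only [Finset.mem_insert, Finset.mem_Iio] at hi ⊢
      rcases hi with rfl | hi
      · exact hpq
      · exact hi.trans hpq
    have h := Finset.sum_le_sum_of_subset (f := n) this
    rw [Finset.sum_insert (by simp)] at h
    omega
  have hjj : j' = j := by
    have p1 := hnpos j
    have p2 := hnpos j'
    rcases lt_trichotomy j' j with h | h | h
    · have := hmono _ _ h; omega
    · exact h
    · have := hmono _ _ h; omega
  subst hjj
  have hδδ : δ' = δ := by omega
  subst hδδ
  have hδn : δ' ≤ n j' := by omega
  let e : Fin ℓ → ℕ := fun i => if i < j' then n i else if i = j' then δ' else 0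
  have hIio : ∀ i ∈ Finset.Iio j', e i = n i := by
    intro i hi; simp only [e]; rw [if_pos (Finset.mem_Iio.1 hi)]
  have hej : e j' = δ' := by simp [e]
  have hIci : ∀ i ∈ Finset.Ici j', i ≠ j' → e i = 0 := by
    intro i hi hne
    simp only [e]; rw [if_neg (not_lt.2 (Finset.mem_Ici.1 hi)), if_neg hne]
  have hen : ∀ i, e i ≤ n i := by
    intro i
    simp only [e]; split_ifs with h1 h2
    · exact le_rfl
    · subst h2; exact hδn
    · exact Nat.zero_le _
  have he : ∑ i, e i = ∑ i ∈ Finset.Iio j', n i + δ' := by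
    rw [hsplit, Finset.sum_congr rfl hIio,
      Finset.sum_eq_single_of_mem j' (by simp) hIci, hej]
  have hme : ∑ i, m i * e i = ∑ i ∈ Finset.Iio j', m i * n i + m j' * δ' := by
    have h1 : ∑ i ∈ Finset.Iio j', m i * e i = ∑ i ∈ Finset.Iio j', m i * n i :=
      Finset.sum_congr rfl fun i hi => by rw [hIio i hi]
    have h2 : ∑ i ∈ Finset.Ici j', m i * e i = m j' * e j' :=
      Finset.sum_eq_single_of_mem j' (by simp) fun i hi hne => by rw [hIci i hi hne, mul_zero]
    rw [hsplit, h1, h2, hej]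
  have hle : δ' * m j' ≤ ∑ i ∈ Finset.Ici j', m i * n i := by
    have h1 : m j' * n j' ≤ ∑ i ∈ Finset.Ici j', m i * n i :=
      Finset.single_le_sum (f := fun i => m i * n i) (fun _ _ => Nat.zero_le _) (by simp)
    have h2 : δ' * m j' ≤ m j' * n j' := by
      rw [mul_comm]; exact Nat.mul_le_mul_left _ hδn
    omega
  rw [← hme]
  apply genWt_core hm hnm 𝒞 e hen (by rw [hd, he]) ?_ r hr hrdim
  rw [hme, hsplit fun i => m i * n i, hdim', mul_comm (m j')]
  omega
end

section
/- (MacWilliams identity for the rank-list distribution) Let 𝒞 ⊆ 𝕄 be a code. Then for every v ∈ ℤ_{≥0}^{ℓ}: W_v(𝒞^⊥) = (1/|𝒞|) · Σ_{u ∈ ℤ_{≥0}^{ℓ}} W_u(𝒞) · Σ_{w ≤ v} q^{Σ_{i=1}^{ℓ} m_i w_i} · Π_{i=1}^{ℓ} (−1)^{v_i − w_i} q^{C(v_i − w_i, 2)} [n_i − u_i choose w_i]_q [n_i − w_i choose v_i − w_i]_q, where the inner sum is over w ∈ ℤ_{≥0}^{ℓ} with w_i ≤ v_i for all i and C(a,2)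 = a(a−1)/2. -/
open Matrix Finset

/-- The `q`-ary Gaussian binomial coefficient `[a choose b]_q` for integers `a b`. -/
noncomputable def gauss (q : ℚ) (a b : ℤ) : ℚ :=
  if a < 0 ∨ b < 0 ∨ a < b then 0
  else if b = 0 then 1
  else (∏ i ∈ Finset.range b.toNat, (q ^ (a - i).toNat - 1)) /
       (∏ i ∈ Finset.range b.toNat, (q ^ (i + 1) - 1))

/-- The rank-list distribution `W_u(𝒞)`: the number of codewords whose `i`-th block has rank
`u i` for all `i`. -/
noncomputable def Wlist {F : Type*} [Field F] [Fintype F] {ℓ : ℕ} {m n : Fin ℓ → ℕ}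
    (𝒞 : Submodule F (∀ i : Fin ℓ, Matrix (Fin (m i)) (Fin (n i)) F)) (u : Fin ℓ → ℕ) : ℕ :=
  Nat.card {C : ∀ i : Fin ℓ, Matrix (Fin (m i)) (Fin (n i)) F //
    C ∈ 𝒞 ∧ ∀ i, (C i).rank = u i}

/-- The `q`-factorial, up to a power of `q - 1`. -/
def qfac (q : ℚ) (a : ℕ) : ℚ := ∏ i ∈ Finset.range a, (q ^ (i + 1) - 1)

/-- Gaussian coefficient on naturals. -/
noncomputable def qbin (q : ℚ) (a b : ℕ) : ℚ :=
  if b ≤ a then qfac q a / (qfac q b * qfac q (a - b)) else 0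

lemma qfac_ne {q : ℚ} (hq : 1 < q) (a : ℕ) : qfac q a ≠ 0 := by
  unfold qfac
  refine Finset.prod_ne_zero_iff.2 fun i _ => ?_
  have := one_lt_pow₀ hq (Nat.succ_ne_zero i)
  exact sub_ne_zero.2 this.ne'

lemma qfac_succ (q : ℚ) (a : ℕ) : qfac q (a + 1) = qfac q a * (q ^ (a + 1) - 1) := by
  simp [qfac, Finset.prod_range_succ]

lemma qfac_top {q : ℚ} (a b : ℕ) :
    qfac q (a + b) = qfac q a * ∏ i ∈ Finset.range b, (q ^ (a + b - i) - 1) := by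
  induction b with
  | zero => simp
  | succ b ih =>
    rw [Finset.prod_range_succ', ← add_assoc, qfac_succ, ih]
    have : ∏ i ∈ Finset.range b, (q ^ (a + b + 1 - (i + 1)) - 1) =
        ∏ i ∈ Finset.range b, (q ^ (a + b - i) - 1) := by
      refine Finset.prod_congr rfl fun i _ => ?_
      congr 2; omega
    rw [this]; simp; ring

lemma gauss_eq {q : ℚ} (hq : 1 < q) (a b : ℕ) : gauss q a b = qbin q a b := by
  unfold gauss qbin
  by_cases h : b ≤ a
  · have h0 : ¬ ((a : ℤ) < 0 ∨ (b : ℤ) < 0 ∨ (a : ℤ) < b) := by omega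
    rw [if_neg h0, if_pos h]
    have hb := qfac_ne hq b
    have hab := qfac_ne hq (a - b)
    obtain ⟨c, rfl⟩ := Nat.exists_eq_add_of_le' h
    have e : ∏ i ∈ Finset.range (b : ℤ).toNat, (q ^ (((c + b : ℕ) : ℤ) - i).toNat - 1) =
        ∏ i ∈ Finset.range b, (q ^ (c + b - i) - 1) := by
      simp only [Int.toNat_natCast]
      refine Finset.prod_congr rfl fun i _ => ?_
      congr 2; omega
    rw [e, qfac_top, Nat.add_sub_cancel] at *
    split_ifs with h1
    · have : b = 0 := by omega
      subst this
      simp [qfac]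
      exact (div_self (by simpa [qfac] using hab)).symm
    · have : ∏ i ∈ Finset.range (b : ℤ).toNat, (q ^ (i + 1) - 1) = qfac q b := by simp [qfac]
      rw [this]
      field_simp
  · rw [if_pos (by omega), if_neg h]

lemma qbin_zero {q : ℚ} (hq : 1 < q) (a : ℕ) : qbin q a 0 = 1 := by
  have h0 : qfac q 0 = 1 := by simp [qfac]
  simp [qbin, h0, qfac_ne hq a]

lemma qbin_gt {q : ℚ} {a b : ℕ} (h : a < b) : qbin q a b = 0 := by
  simp [qbin, h]

lemma qbin_symm {q : ℚ} {a b : ℕ} (h : b ≤ a) : qbin q a (a - b) = qbin q a b := by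
  simp [qbin, h, Nat.sub_sub_self h, mul_comm]

lemma qbin_pascal {q : ℚ} (hq : 1 < q) (a b : ℕ) :
    qbin q (a + 1) (b + 1) = qbin q a b + q ^ (b + 1) * qbin q a (b + 1) := by
  rcases lt_trichotomy a b with h | h | h
  · rw [qbin_gt (by omega), qbin_gt h, qbin_gt (by omega)]; simp
  · subst h
    have := qfac_ne hq a
    have := qfac_ne hq (a + 1)
    have h0 : qfac q 0 = 1 := by simp [qfac]
    rw [qbin_gt (show a < a + 1 by omega)]
    simp [qbin, h0]
    field_simp
  · obtain ⟨c, rfl⟩ := Nat.exists_eq_add_of_lt h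
    have h1 := qfac_ne hq b
    have h2 := qfac_ne hq c
    have h3 := qfac_ne hq (b + 1)
    have h4 := qfac_ne hq (c + 1)
    have e1 : b + c + 1 + 1 - (b + 1) = c + 1 := by omega
    have e2 : b + c + 1 - b = c + 1 := by omega
    have e3 : b + c + 1 - (b + 1) = c := by omega
    unfold qbin
    rw [if_pos (by omega), if_pos (by omega), if_pos (by omega), e1, e2, e3]
    rw [qfac_succ q (b + c + 1)]
    rw [qfac_succ] at h3 h4
    rw [qfac_succ q b, qfac_succ q c]
    have h5 : (q ^ (b + 1) - 1) ≠ 0 := right_ne_zero_of_mul h3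
    have h6 : (q ^ (c + 1) - 1) ≠ 0 := right_ne_zero_of_mul h4
    field_simp
    ring

lemma qbin_alt_partial {q : ℚ} (hq : 1 < q) (N K : ℕ) :
    ∑ k ∈ Finset.range (K + 1), (-1 : ℚ) ^ k * q ^ (k.choose 2) * qbin q (N + 1) k =
      (-1) ^ K * q ^ ((K + 1).choose 2) * qbin q N K := by
  induction K with
  | zero => simp [qbin_zero hq]
  | succ K ih =>
    rw [Finset.sum_range_succ, ih, qbin_pascal hq]
    rw [show (K + 1 + 1).choose 2 = (K + 1) + (K + 1).choose 2 by
      rw [Nat.choose_succ_succ' (K + 1) 1]; simp]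
    ring

lemma qbin_alt {q : ℚ} (hq : 1 < q) (N : ℕ) :
    ∑ k ∈ Finset.range (N + 1), (-1 : ℚ) ^ k * q ^ (k.choose 2) * qbin q N k =
      if N = 0 then 1 else 0 := by
  cases N with
  | zero => simp [qbin_zero hq]
  | succ N =>
    rw [qbin_alt_partial hq, qbin_gt (by omega)]; simp

lemma qbin_trinom {q : ℚ} (hq : 1 < q) {n j w v : ℕ} (h1 : j ≤ w) (h2 : w ≤ v) (h3 : v ≤ n) :
    qbin q (n - j) (w - j) * qbin q (n - w) (v - w) =
      qbin q (n - j) (v - j) * qbin q (v - j) (v - w) := by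
  unfold qbin
  rw [if_pos (by omega), if_pos (by omega), if_pos (by omega), if_pos (by omega)]
  rw [show n - j - (w - j) = n - w by omega, show n - w - (v - w) = n - v by omega,
    show n - j - (v - j) = n - v by omega, show v - j - (v - w) = w - j by omega]
  have a1 := qfac_ne hq (w - j)
  have a2 := qfac_ne hq (n - w)
  have a3 := qfac_ne hq (v - w)
  have a4 := qfac_ne hq (n - v)
  have a5 := qfac_ne hq (v - j)
  field_simp

/-- orthogonality relation -/
lemma qbin_orth {q : ℚ} (hq : 1 < q) {n j v : ℕ} (h3 : v ≤ n) :
    ∑ w ∈ Finset.range (v + 1), ((-1 : ℚ) ^ (v - w) * q ^ ((v - w).choose 2) *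
      qbin q (n - w) (v - w)) * (if j ≤ w then qbin q (n - j) (w - j) else 0) =
      if j = v then 1 else 0 := by
  by_cases hj : j ≤ v
  · obtain ⟨N, rfl⟩ := Nat.exists_eq_add_of_le hj
    have : (if j = j + N then (1 : ℚ) else 0) = if N = 0 then 1 else 0 := by
      congr 1; simp
    rw [this, ← Finset.sum_range_reflect]
    have key : ∀ k ∈ Finset.range (j + N + 1),
        ((-1 : ℚ) ^ (j + N - (j + N + 1 - 1 - k)) *
          q ^ ((j + N - (j + N + 1 - 1 - k)).choose 2) *
          qbin q (n - (j + N + 1 - 1 - k)) (j + N - (j + N + 1 - 1 - k))) *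
          (if j ≤ j + N + 1 - 1 - k then qbin q (n - j) (j + N + 1 - 1 - k - j) else 0) =
        qbin q (n - j) N * ((-1 : ℚ) ^ k * q ^ (k.choose 2) * qbin q N k) := by
      intro k hk
      rw [Finset.mem_range] at hk
      have e : j + N - (j + N + 1 - 1 - k) = k := by omega
      rw [e]
      by_cases hkN : k ≤ N
      · rw [if_pos (by omega)]
        have := qbin_trinom hq (n := n) (j := j) (w := j + N - k) (v := j + N)
          (by omega) (by omega) h3
        rw [show j + N - (j + N - k) = k by omega, show j + N - j = N by omega] at this
        rw [show j + N + 1 - 1 - k = j + N - k by omega]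
        linear_combination (-1 : ℚ) ^ k * q ^ (k.choose 2) * this
      · rw [if_neg (by omega), qbin_gt (show N < k by omega)]; simp
    rw [Finset.sum_congr rfl key, ← Finset.mul_sum]
    have hs : ∑ k ∈ Finset.range (j + N + 1), (-1 : ℚ) ^ k * q ^ (k.choose 2) * qbin q N k =
        ∑ k ∈ Finset.range (N + 1), (-1 : ℚ) ^ k * q ^ (k.choose 2) * qbin q N k := by
      symm
      apply Finset.sum_subset
      · intro x; simp only [Finset.mem_range]; omega
      · intro x _ hx
        rw [Finset.mem_range] at hx
        rw [qbin_gt (by omega)]; simp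
    rw [hs, qbin_alt hq]
    split_ifs with h
    · subst h; simp [qbin_zero hq]
    · simp
  · rw [if_neg (by omega)]
    apply Finset.sum_eq_zero
    intro w hw
    rw [Finset.mem_range] at hw
    rw [if_neg (by omega)]; simp
lemma prod_pow_sub {q : ℚ} (a k : ℕ) (h : k ≤ a) :
    (∏ i ∈ Finset.range k, (q ^ a - q ^ i)) * qfac q (a - k) =
      (∏ i ∈ Finset.range k, q ^ i) * qfac q a := by
  obtain ⟨c, rfl⟩ := Nat.exists_eq_add_of_le' h
  rw [Nat.add_sub_cancel, qfac_top]
  have : ∏ i ∈ Finset.range k, (q ^ (c + k) - q ^ i) =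
      (∏ i ∈ Finset.range k, q ^ i) * ∏ i ∈ Finset.range k, (q ^ (c + k - i) - 1) := by
    rw [← Finset.prod_mul_distrib]
    refine Finset.prod_congr rfl fun i hi => ?_
    rw [Finset.mem_range] at hi
    rw [mul_sub, ← pow_add, mul_one]
    congr 2; omega
  rw [this]; ring

section Count
variable {F : Type*} [Field F] [Fintype F]

lemma one_lt_cardQ : (1 : ℚ) < (Fintype.card F : ℚ) := by
  exact_mod_cast Fintype.one_lt_card

/-- Fibre of the span map. -/
noncomputable def fiberEquiv {V : Type*} [AddCommGroup V] [Module F V] [Finite V] {k : ℕ}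
    (U : Submodule F V) (hU : Module.finrank F U = k) :
    {s : {s : Fin k → V // LinearIndependent F s} //
      Submodule.span F (Set.range s.1) = U} ≃ {t : Fin k → U // LinearIndependent F t} where
  toFun s := ⟨fun i => ⟨s.1.1 i, by
      have := Submodule.subset_span (R := F) (Set.mem_range_self (f := s.1.1) i)
      rw [s.2] at this; exact this⟩, by
      apply LinearIndependent.of_comp U.subtype
      exact s.1.2⟩
  invFun t := ⟨⟨fun i => (t.1 i : V), t.2.map' U.subtype (Submodule.ker_subtype U)⟩, by
      have hli := t.2.map' U.subtype (Submodule.ker_subtype U)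
      apply Submodule.eq_of_le_of_finrank_eq
      · rw [Submodule.span_le]
        rintro _ ⟨i, rfl⟩
        exact (t.1 i).2
      · rw [hU]
        have := finrank_span_eq_card hli
        rw [Fintype.card_fin] at this
        exact this⟩
  left_inv s := rfl
  right_inv t := rfl

lemma card_li_Q {V : Type*} [AddCommGroup V] [Module F V] [Finite V] {k : ℕ}
    (hk : k ≤ Module.finrank F V) :
    (Nat.card {s : Fin k → V // LinearIndependent F s} : ℚ) =
      ∏ i ∈ Finset.range k, ((Fintype.card F : ℚ) ^ (Module.finrank F V) -
        (Fintype.card F : ℚ) ^ i) := by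
  rw [card_linearIndependent hk, Nat.cast_prod, Finset.prod_range]
  refine Finset.prod_congr rfl fun i _ => ?_
  rw [Nat.cast_sub (Nat.pow_le_pow_right Fintype.card_pos (by omega))]
  push_cast; rfl

lemma card_subspaces {V : Type*} [AddCommGroup V] [Module F V] [Finite V] (k : ℕ) :
    (Nat.card {U : Submodule F V // Module.finrank F U = k} : ℚ) =
      qbin (Fintype.card F) (Module.finrank F V) k := by
  by_cases hk : k ≤ Module.finrank F V
  · classical
    have : Fintype {U : Submodule F V // Module.finrank F U = k} := Fintype.ofFinite _
    let f : {s : Fin k → V // LinearIndependent F s} →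
        {U : Submodule F V // Module.finrank F U = k} :=
      fun s => ⟨Submodule.span F (Set.range s.1), by simpa using finrank_span_eq_card s.2⟩
    have h1 := Nat.card_congr (Equiv.sigmaFiberEquiv f).symm
    rw [Nat.card_sigma] at h1
    have h2 : ∀ U : {U : Submodule F V // Module.finrank F U = k},
        (Nat.card {s // f s = U} : ℚ) = ∏ i ∈ Finset.range k, ((Fintype.card F : ℚ) ^ k -
        (Fintype.card F : ℚ) ^ i) := by
      intro U
      have e : {s // f s = U} ≃ {s : {s : Fin k → V // LinearIndependent F s} //
          Submodule.span F (Set.range s.1) = U.1} :=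
        Equiv.subtypeEquivRight fun s => by simp [f, Subtype.ext_iff]
      rw [Nat.card_congr (e.trans (fiberEquiv U.1 U.2)), card_li_Q U.2.ge, U.2]
    have h3 : (Nat.card {s : Fin k → V // LinearIndependent F s} : ℚ) =
        Nat.card {U : Submodule F V // Module.finrank F U = k} *
          ∏ i ∈ Finset.range k, ((Fintype.card F : ℚ) ^ k - (Fintype.card F : ℚ) ^ i) := by
      rw [h1, Nat.cast_sum, Finset.sum_congr rfl (fun U _ => h2 U)]
      simp
    rw [card_li_Q hk] at h3
    have hq := one_lt_cardQ (F := F)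
    have p1 := prod_pow_sub (q := (Fintype.card F : ℚ)) _ _ hk
    have p2 := prod_pow_sub (q := (Fintype.card F : ℚ)) k k le_rfl
    have hz : qfac (Fintype.card F : ℚ) (k - k) = 1 := by simp [qfac]
    rw [h3] at p1
    rw [hz, mul_one] at p2
    rw [p2] at p1
    have hne : (∏ i ∈ Finset.range k, (Fintype.card F : ℚ) ^ i) ≠ 0 :=
      Finset.prod_ne_zero_iff.2 fun i _ => pow_ne_zero _ (by positivity)
    have a1 := qfac_ne hq k
    have a2 := qfac_ne hq (Module.finrank F V - k)
    rw [qbin, if_pos hk, eq_div_iff (mul_ne_zero a1 a2)]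
    apply mul_left_cancel₀ hne
    linear_combination p1
  · rw [qbin_gt (by omega)]
    have : IsEmpty {U : Submodule F V // Module.finrank F U = k} := by
      refine ⟨fun U => hk ?_⟩
      rw [← U.2]
      exact Submodule.finrank_le _
    simp

lemma card_subspaces_le {V : Type*} [AddCommGroup V] [Module F V] [Finite V] (k : ℕ)
    (S : Submodule F V) :
    (Nat.card {U : Submodule F V // U ≤ S ∧ Module.finrank F U = k} : ℚ) =
      qbin (Fintype.card F) (Module.finrank F S) k := by
  rw [← card_subspaces]
  congr 1
  refine Nat.card_congr (Equiv.symm ?_)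
  refine (Equiv.subtypeEquiv (q := fun U : Set.Iic S => Module.finrank F U.1 = k)
    (Submodule.mapIic S).toEquiv fun U => ?_).trans
    (Equiv.subtypeSubtypeEquivSubtypeInter (fun U => U ≤ S) (fun U => Module.finrank F U = k))
  change _ ↔ Module.finrank F (Submodule.map S.subtype U) = k
  rw [Submodule.finrank_map_subtype_eq]

lemma card_subspaces_ge {V : Type*} [AddCommGroup V] [Module F V] [Finite V] (k : ℕ)
    (R : Submodule F V) :
    (Nat.card {U : Submodule F V // R ≤ U ∧ Module.finrank F U = k} : ℚ) =
      if Module.finrank F R ≤ k then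
      qbin (Fintype.card F) (Module.finrank F V - Module.finrank F R)
        (k - Module.finrank F R) else 0 := by
  split_ifs with h
  · have hf : Module.finrank F V - Module.finrank F R = Module.finrank F (V ⧸ R) := by
      have := Submodule.finrank_quotient_add_finrank R
      omega
    have : Finite (V ⧸ R) := Finite.of_surjective _ (Submodule.mkQ_surjective R)
    rw [hf, ← card_subspaces]
    congr 1
    refine Nat.card_congr (Equiv.symm ?_)
    refine (Equiv.subtypeEquiv (q := fun U : Set.Ici R => Module.finrank F U.1 = k)
      (Submodule.comapMkQRelIso R).toEquiv fun U => ?_).trans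
      (Equiv.subtypeSubtypeEquivSubtypeInter (fun U => R ≤ U) (fun U => Module.finrank F U = k))
    have : Module.finrank F (Submodule.comap R.mkQ U) =
        Module.finrank F U + Module.finrank F R := by
      have h1 := Submodule.finrank_quotient_add_finrank (Submodule.comap R.mkQ U)
      have h2 := Submodule.finrank_quotient_add_finrank U
      have h3 := Submodule.finrank_quotient_add_finrank R
      have h4 := (U.mkQ ∘ₗ R.mkQ).finrank_range_add_finrank_ker
      rw [LinearMap.ker_comp, Submodule.ker_mkQ, LinearMap.range_eq_top.2
        (by rw [LinearMap.coe_comp]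
            exact (Submodule.mkQ_surjective U).comp (Submodule.mkQ_surjective R)),
        finrank_top] at h4
      omega
    change _ ↔ Module.finrank F (Submodule.comap R.mkQ U) = k
    omega
  · have : IsEmpty {U : Submodule F V // R ≤ U ∧ Module.finrank F U = k} := by
      refine ⟨fun U => h ?_⟩
      rw [← U.2.2]
      exact Submodule.finrank_mono U.2.1
    simp

lemma sum_char (χ : AddChar F ℂ) (hχ : χ ≠ 0) {V : Type*} [AddCommGroup V] [Module F V]
    (S : Submodule F V) [Fintype S] (f : V →ₗ[F] F) [Decidable (∀ x ∈ S, f x = 0)] :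
    ∑ x : S, χ (f x) = if ∀ x ∈ S, f x = 0 then (Fintype.card S : ℂ) else 0 := by
  classical
  let ψ : AddChar S ℂ := χ.compAddMonoidHom (f ∘ₗ S.subtype).toAddMonoidHom
  have h := AddChar.sum_eq_ite ψ
  change ∑ x : S, ψ x = _
  rw [h]
  congr 1
  apply propext
  constructor
  · intro h0
    by_contra! hne
    obtain ⟨x, hx, hfx⟩ := hne
    apply hχ
    ext a
    have : ψ ((a / f x) • ⟨x, hx⟩) = 1 := by rw [h0]; simp
    simpa [ψ, hfx] using this
  · intro h0
    ext x
    simp [ψ, h0 x.1 x.2]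

section Block
variable {m n : ℕ}

open Classical in
/-- block character sum -/
noncomputable def kraw (χ : AddChar F ℂ) (C : Matrix (Fin m) (Fin n) F) (v : ℕ) : ℂ :=
  ∑ D : Matrix (Fin m) (Fin n) F, if D.rank = v then χ (Matrix.trace (D * Cᵀ)) else 0

lemma trace_mul_tr (D C : Matrix (Fin m) (Fin n) F) :
    Matrix.trace (D * Cᵀ) = ∑ i, (C *ᵥ (D.row i)) i := by
  simp [Matrix.trace, Matrix.mul_apply, Matrix.mulVec, dotProduct, mul_comm, Matrix.row]

open Classical in
lemma sum_char_block (χ : AddChar F ℂ) (hχ : χ ≠ 0) (C : Matrix (Fin m) (Fin n) F)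
    (U : Submodule F (Fin n → F)) :
    (∑ D : Matrix (Fin m) (Fin n) F, if ∀ i, D.row i ∈ U then χ (Matrix.trace (D * Cᵀ)) else 0) =
      if U ≤ LinearMap.ker C.mulVecLin then
        (Fintype.card F : ℂ) ^ (m * Module.finrank F U) else 0 := by
  let S : Submodule F (Matrix (Fin m) (Fin n) F) :=
    { carrier := {D | ∀ i, D.row i ∈ U}
      add_mem' := fun ha hb i => U.add_mem (ha i) (hb i)
      zero_mem' := fun i => U.zero_mem
      smul_mem' := fun c _ ha i => U.smul_mem c (ha i) }
  have hS : ∀ D : Matrix (Fin m) (Fin n) F, D ∈ S ↔ ∀ i, D.row i ∈ U := fun D => Iff.rfl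
  let f : Matrix (Fin m) (Fin n) F →ₗ[F] F :=
    { toFun := fun D => Matrix.trace (D * Cᵀ)
      map_add' := by intro a b; simp [Matrix.add_mul]
      map_smul' := by intro a b; simp }
  have hsum := sum_char χ hχ S f
  have hL : (∑ D : Matrix (Fin m) (Fin n) F,
      if ∀ i, D.row i ∈ U then χ (Matrix.trace (D * Cᵀ)) else 0) = ∑ x : S, χ (f x) := by
    rw [← Finset.sum_filter]
    rw [← Finset.sum_subtype (Finset.univ.filter fun D : Matrix (Fin m) (Fin n) F =>
      ∀ i, D.row i ∈ U) (fun D => by simp [hS]) (fun D => χ (f D))]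
    rfl
  rw [hL, hsum]
  have hcard : Fintype.card S = Fintype.card F ^ (m * Module.finrank F U) := by
    have e : S ≃ (Fin m → U) :=
      { toFun := fun D i => ⟨D.1.row i, (hS _).1 D.2 i⟩
        invFun := fun g => ⟨Matrix.of fun i => (g i).1, (hS _).2 fun i => (g i).2⟩
        left_inv := fun _ => rfl
        right_inv := fun _ => rfl }
    rw [Fintype.card_congr e, Fintype.card_fun, Module.card_eq_pow_finrank (K := F) (V := U),
      Fintype.card_fin, ← pow_mul, mul_comm]
  have hiff : (∀ x ∈ S, f x = 0) ↔ U ≤ LinearMap.ker C.mulVecLin := by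
    constructor
    · intro h x hx
      rw [LinearMap.mem_ker, Matrix.mulVecLin_apply]
      ext i
      have h1 : (Matrix.of fun j => if j = i then x else 0 : Matrix (Fin m) (Fin n) F) ∈ S := by
        rw [hS]; intro j; change (if j = i then x else 0) ∈ U; split_ifs
        · exact hx
        · exact U.zero_mem
      have h2 := h _ h1
      simp only [f, LinearMap.coe_mk, AddHom.coe_mk] at h2
      have hrow : ∀ j, (Matrix.of fun j => if j = i then x else 0 :
          Matrix (Fin m) (Fin n) F).row j = if j = i then x else 0 := fun _ => rfl
      rw [trace_mul_tr] at h2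
      simp only [hrow] at h2
      rw [Finset.sum_eq_single i] at h2
      · simpa using h2
      · intro j _ hj
        simp [hj]
      · simp
    · intro h D hD
      simp only [f, LinearMap.coe_mk, AddHom.coe_mk]
      rw [trace_mul_tr]
      apply Finset.sum_eq_zero
      intro i _
      have := h ((hS D).1 hD i)
      rw [LinearMap.mem_ker, Matrix.mulVecLin_apply] at this
      rw [this]; rfl
  simp only [hiff, hcard, Nat.cast_pow]

lemma sum_indicator {α : Type*} [Fintype α] (p : α → Prop) [DecidablePred p] (c : ℂ) :
    (∑ x, if p x then c else 0) = (Nat.card {x // p x} : ℂ) * c := by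
  rw [← Finset.sum_filter, Finset.sum_const, Nat.card_eq_fintype_card, Fintype.card_subtype,
    nsmul_eq_mul]

lemma kraw_moment (χ : AddChar F ℂ) (hχ : χ ≠ 0) (C : Matrix (Fin m) (Fin n) F) (w : ℕ) :
    (∑ j ∈ Finset.range (n + 1), kraw χ C j *
      (((if j ≤ w then qbin (Fintype.card F) (n - j) (w - j) else 0) : ℚ) : ℂ)) =
      (Fintype.card F : ℂ) ^ (m * w) * (qbin (Fintype.card F) (n - C.rank) w : ℚ) := by
  classical
  have : Fintype (Submodule F (Fin n → F)) := Fintype.ofFinite _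
  have hA : (∑ U : Submodule F (Fin n → F), if Module.finrank F U = w then
      ∑ D : Matrix (Fin m) (Fin n) F, if ∀ i, D.row i ∈ U then χ (Matrix.trace (D * Cᵀ)) else 0
      else 0) = (Fintype.card F : ℂ) ^ (m * w) * (qbin (Fintype.card F) (n - C.rank) w : ℚ) := by
    have hk : Module.finrank F (LinearMap.ker C.mulVecLin) = n - C.rank := by
      have := C.mulVecLin.finrank_range_add_finrank_ker
      rw [Module.finrank_fin_fun] at this
      rw [Matrix.rank]; omega
    rw [← hk, ← card_subspaces_le, Rat.cast_natCast, mul_comm, ← sum_indicator]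
    refine Finset.sum_congr rfl fun U _ => ?_
    rw [sum_char_block χ hχ]
    by_cases h1 : Module.finrank F U = w <;> by_cases h2 : U ≤ LinearMap.ker C.mulVecLin <;>
      simp [h1, h2]
  rw [← hA]
  have hR : ∀ D : Matrix (Fin m) (Fin n) F, D.rank ∈ Finset.range (n + 1) := fun D => by
    have := D.rank_le_width
    rw [Finset.mem_range]; omega
  have hB : ∀ D : Matrix (Fin m) (Fin n) F, (∑ U : Submodule F (Fin n → F),
      if (∀ i, D.row i ∈ U) ∧ Module.finrank F U = w then χ (Matrix.trace (D * Cᵀ)) else 0) =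
      ∑ j ∈ Finset.range (n + 1), (if D.rank = j then χ (Matrix.trace (D * Cᵀ)) else 0) *
      (((if j ≤ w then qbin (Fintype.card F) (n - j) (w - j) else 0) : ℚ) : ℂ) := by
    intro D
    rw [sum_indicator, Finset.sum_eq_single_of_mem _ (hR D)
      (fun j _ hj => by rw [if_neg hj.symm, zero_mul]), if_pos rfl, mul_comm]
    congr 1
    have h := card_subspaces_ge (F := F) w (Submodule.span F (Set.range D.row))
    rw [← Matrix.rank_eq_finrank_span_row, Module.finrank_fin_fun] at h
    rw [← h, Rat.cast_natCast]
    congr 1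
    refine Nat.card_congr (Equiv.subtypeEquivRight fun U => ?_)
    rw [Submodule.span_le, Set.range_subset_iff]
    rfl
  have hC : (∑ U : Submodule F (Fin n → F), if Module.finrank F U = w then
      ∑ D : Matrix (Fin m) (Fin n) F, if ∀ i, D.row i ∈ U then χ (Matrix.trace (D * Cᵀ)) else 0
      else 0) = ∑ U : Submodule F (Fin n → F), ∑ D : Matrix (Fin m) (Fin n) F,
      if (∀ i, D.row i ∈ U) ∧ Module.finrank F U = w then χ (Matrix.trace (D * Cᵀ)) else 0 := by
    refine Finset.sum_congr rfl fun U _ => ?_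
    split_ifs with h
    · simp only [h, and_true]
    · simp [h]
  rw [hC, Finset.sum_comm, Finset.sum_congr rfl (fun D _ => hB D), Finset.sum_comm]
  refine Finset.sum_congr rfl fun j _ => ?_
  rw [kraw, Finset.sum_mul]

lemma gauss_sub {q : ℚ} (hq : 1 < q) {n w v : ℕ} (hw : w ≤ v) :
    gauss q ((n : ℤ) - (w : ℤ)) ((v : ℤ) - (w : ℤ)) =
      if v ≤ n then qbin q (n - w) (v - w) else 0 := by
  split_ifs with h
  · rw [← gauss_eq hq, Nat.cast_sub (by omega), Nat.cast_sub hw]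
  · rw [gauss, if_pos (by omega)]

/-- The Krawtchouk value in the statement. -/
noncomputable def krawQ (q : ℚ) (m n v u : ℕ) : ℚ :=
  ∑ w : Fin (v + 1), q ^ (m * (w : ℕ)) * ((-1 : ℚ) ^ (v - (w : ℕ)) *
              q ^ ((v - (w : ℕ)).choose 2) *
              gauss q ((n : ℤ) - (u : ℤ)) ((w : ℕ) : ℤ) *
              gauss q ((n : ℤ) - ((w : ℕ) : ℤ))
                ((v : ℤ) - ((w : ℕ) : ℤ)))

lemma kraw_eq (χ : AddChar F ℂ) (hχ : χ ≠ 0) (C : Matrix (Fin m) (Fin n) F) (v : ℕ) :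
    kraw χ C v = (krawQ (Fintype.card F) m n v C.rank : ℚ) := by
  have hq := one_lt_cardQ (F := F)
  have hrk : C.rank ≤ n := C.rank_le_width
  by_cases hv : v ≤ n
  · have h1 : kraw χ C v = ∑ j ∈ Finset.range (n + 1), kraw χ C j *
        (((if j = v then 1 else 0) : ℚ) : ℂ) := by
      rw [Finset.sum_eq_single_of_mem v (by rw [Finset.mem_range]; omega)
        (fun j _ hj => by simp [hj])]
      simp
    rw [h1]
    simp only [← qbin_orth hq hv]
    push_cast
    simp only [Finset.mul_sum]
    rw [Finset.sum_comm, krawQ, ← Fin.sum_univ_eq_sum_range (fun w => ∑ j ∈ Finset.range (n + 1),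
      kraw χ C j * _), Rat.cast_sum]
    refine Finset.sum_congr rfl fun w _ => ?_
    have hm := kraw_moment χ hχ C (w : ℕ)
    rw [gauss_sub hq (by omega), if_pos hv, ← Nat.cast_sub hrk, gauss_eq hq]
    push_cast at hm ⊢
    trans ((-1 : ℂ) ^ (v - (w : ℕ)) * (Fintype.card F : ℂ) ^ ((v - (w : ℕ)).choose 2) *
      (qbin (Fintype.card F) (n - (w : ℕ)) (v - (w : ℕ)) : ℚ)) *
      ((Fintype.card F : ℂ) ^ (m * (w : ℕ)) * (qbin (Fintype.card F) (n - C.rank) w : ℚ))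
    · rw [← hm, Finset.mul_sum]
      refine Finset.sum_congr rfl fun j _ => ?_
      ring
    · ring
  · have h0 : krawQ (Fintype.card F) m n v C.rank = 0 := by
      apply Finset.sum_eq_zero
      intro w _
      rw [gauss_sub hq (by omega), if_neg hv]; simp
    rw [h0, kraw, Rat.cast_zero]
    apply Finset.sum_eq_zero
    intro D _
    have := D.rank_le_width
    rw [if_neg (by omega)]
end Block
end Count

section Main
variable {F : Type*} [Field F] [Fintype F] {ℓ : ℕ} {m n : Fin ℓ → ℕ}

lemma inner_eq (q : ℚ) (u v : Fin ℓ → ℕ) :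
    (∑ w : (∀ i : Fin ℓ, Fin (v i + 1)),
            q ^ (∑ i, m i * (w i : ℕ)) *
            ∏ i, ((-1 : ℚ) ^ (v i - (w i : ℕ)) *
              q ^ ((v i - (w i : ℕ)).choose 2) *
              gauss q ((n i : ℤ) - (u i : ℤ)) ((w i : ℕ) : ℤ) *
              gauss q ((n i : ℤ) - ((w i : ℕ) : ℤ))
                ((v i : ℤ) - ((w i : ℕ) : ℤ)))) =
    ∏ i, krawQ q (m i) (n i) (v i) (u i) := by
  unfold krawQ
  rw [Finset.prod_univ_sum, Fintype.piFinset_univ]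
  refine Finset.sum_congr rfl fun w _ => ?_
  rw [← Finset.prod_pow_eq_pow_sum, ← Finset.prod_mul_distrib]

lemma finsum_fiber (𝒞 : Submodule F (∀ i : Fin ℓ, Matrix (Fin (m i)) (Fin (n i)) F))
    [Fintype 𝒞] (g : (Fin ℓ → ℕ) → ℚ) :
    ∑ᶠ u : Fin ℓ → ℕ, (Wlist 𝒞 u : ℚ) * g u = ∑ C : 𝒞, g (fun i => (C.1 i).rank) := by
  classical
  let r : 𝒞 → (Fin ℓ → ℕ) := fun C i => (C.1 i).rank
  have hW : ∀ u, Wlist 𝒞 u = (Finset.univ.filter fun C : 𝒞 => r C = u).card := by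
    intro u
    rw [Wlist, ← Fintype.card_subtype, ← Nat.card_eq_fintype_card]
    refine Nat.card_congr ?_
    refine ((Equiv.subtypeSubtypeEquivSubtypeInter (fun C => C ∈ 𝒞)
      (fun C => ∀ i, (C i).rank = u i)).symm).trans (Equiv.subtypeEquivRight fun C => ?_)
    simp [r, funext_iff]
  rw [finsum_eq_sum_of_support_subset (s := Finset.univ.image r)]
  · change _ = ∑ C : 𝒞, g (r C)
    rw [Finset.sum_comp g r]
    refine Finset.sum_congr rfl fun u _ => ?_
    rw [hW, nsmul_eq_mul]
  · intro u hu
    rw [Function.mem_support] at hu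
    have h1 : Wlist 𝒞 u ≠ 0 := by
      intro h; apply hu; simp [h]
    rw [hW, Finset.card_ne_zero] at h1
    obtain ⟨C, hC⟩ := h1
    simp only [Finset.mem_filter, Finset.mem_univ, true_and] at hC
    simp only [Finset.coe_image, Finset.coe_univ, Set.image_univ, Set.mem_range]
    exact ⟨C, hC⟩

lemma dual_count (χ : AddChar F ℂ) (hχ : χ ≠ 0)
    (𝒞 : Submodule F (∀ i : Fin ℓ, Matrix (Fin (m i)) (Fin (n i)) F)) [Fintype 𝒞]
    (v : Fin ℓ → ℕ) :
    (Wlist (dualCode 𝒞) v : ℂ) * (Nat.card 𝒞 : ℂ) =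
      ∑ C : 𝒞, ∏ i, kraw χ (C.1 i) (v i) := by
  classical
  rw [Wlist, ← sum_indicator]
  have h1 : ∀ D : (∀ i : Fin ℓ, Matrix (Fin (m i)) (Fin (n i)) F),
      (if D ∈ dualCode 𝒞 ∧ ∀ i, (D i).rank = v i then (Nat.card 𝒞 : ℂ) else 0) =
      ∑ C : 𝒞, ∏ i, if (D i).rank = v i then χ (Matrix.trace (D i * (C.1 i)ᵀ)) else 0 := by
    intro D
    by_cases hr : ∀ i, (D i).rank = v i
    · let f : (∀ i : Fin ℓ, Matrix (Fin (m i)) (Fin (n i)) F) →ₗ[F] F :=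
        { toFun := fun C => ∑ i, Matrix.trace (D i * (C i)ᵀ)
          map_add' := by
            intro a b
            simp [Matrix.mul_add, Finset.sum_add_distrib]
          map_smul' := by
            intro a b
            simp [Finset.mul_sum] }
      have hs := sum_char χ hχ 𝒞 f
      have hd : D ∈ dualCode 𝒞 ↔ ∀ x ∈ 𝒞, f x = 0 := Iff.rfl
      simp only [hr, hd, implies_true, and_true, if_true]
      rw [Nat.card_eq_fintype_card, ← hs]
      refine Finset.sum_congr rfl fun C _ => ?_
      change χ (∑ i, Matrix.trace (D i * (C.1 i)ᵀ)) = _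
      exact map_prod χ.toMonoidHom
        (fun i => Multiplicative.ofAdd (Matrix.trace (D i * (C.1 i)ᵀ))) Finset.univ
    · rw [if_neg (fun h => hr h.2)]
      push Not at hr
      obtain ⟨i, hi⟩ := hr
      symm
      apply Finset.sum_eq_zero
      intro C _
      exact Finset.prod_eq_zero (Finset.mem_univ i) (if_neg hi)
  rw [Finset.sum_congr rfl (fun D _ => h1 D), Finset.sum_comm]
  refine Finset.sum_congr rfl fun C _ => ?_
  unfold kraw
  rw [Finset.prod_univ_sum, Fintype.piFinset_univ]

end Main

/-- **MacWilliams identity for the rank-list distribution** of sum-rank metric codes. -/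
theorem macwilliams_rank_list {F : Type*} [Field F] [Fintype F] {ℓ : ℕ}
    (m n : Fin ℓ → ℕ) (hℓ : 0 < ℓ) (hm : ∀ i j : Fin ℓ, i ≤ j → m j ≤ m i)
    (hmpos : ∀ i, 0 < m i) (hnm : ∀ i, n i ≤ m i) (hnpos : ∀ i, 0 < n i)
    (𝒞 : Submodule F (∀ i : Fin ℓ, Matrix (Fin (m i)) (Fin (n i)) F))
    (v : Fin ℓ → ℕ) :
    (Wlist (dualCode 𝒞) v : ℚ) =
      (1 / (Nat.card 𝒞 : ℚ)) *
        ∑ᶠ u : Fin ℓ → ℕ, (Wlist 𝒞 u : ℚ) *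
          ∑ w : (∀ i : Fin ℓ, Fin (v i + 1)),
            (Fintype.card F : ℚ) ^ (∑ i, m i * (w i : ℕ)) *
            ∏ i, ((-1 : ℚ) ^ (v i - (w i : ℕ)) *
              (Fintype.card F : ℚ) ^ ((v i - (w i : ℕ)).choose 2) *
              gauss (Fintype.card F) ((n i : ℤ) - (u i : ℤ)) ((w i : ℕ) : ℤ) *
              gauss (Fintype.card F) ((n i : ℤ) - ((w i : ℕ) : ℤ))
                ((v i : ℤ) - ((w i : ℕ) : ℤ))) := by
  classical
  have : Fintype 𝒞 := Fintype.ofFinite _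
  simp only [inner_eq]
  rw [finsum_fiber 𝒞 (fun u => ∏ i, krawQ (Fintype.card F) (m i) (n i) (v i) (u i))]
  let χ := AddChar.FiniteField.primitiveChar_to_Complex F
  have hχ : χ ≠ 0 := by
    intro h
    have hp := AddChar.FiniteField.primitiveChar_to_Complex_isPrimitive F one_ne_zero
    apply hp
    change AddChar.mulShift χ 1 = 1
    rw [h]
    ext x
    simp [AddChar.mulShift_apply]
  have h := dual_count χ hχ 𝒞 v
  simp only [kraw_eq χ hχ] at h
  have hc : (Nat.card 𝒞 : ℚ) ≠ 0 := Nat.cast_ne_zero.2 Nat.card_pos.ne'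
  rw [one_div, eq_inv_mul_iff_mul_eq₀ hc, mul_comm]
  exact_mod_cast h
end
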